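/- arXiv:math/0612842 — 2 statements merged into one kernel-verified Lean document; each statement's English description precedes it below -/
import Mathlib

section
/- The family of standard complementary pfaffians {pf_{I,Ī}(A) : (I,Ī) is a standard partition of [2n] with both |I| and |Ī| even} is an ℝ-basis of the subspace P_n; in particular these elements are linearly independent and every pf_{J,J̄}(A), for J ⊆ [2n] of even cardinality, lies in their span. -/
open scoped Classical
noncomputable section

/-- The crossing number of a matching `π` (pairs written `(i,j)` with `i < j`): the number of
pairs `{i,j}, {k,l}` of `π` with `i < k < j < l`. -/
def crossNum (π : Finset (ℕ × ℕ)) : ℕ :=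
  ((π ×ˢ π).filter fun pq => pq.1.1 < pq.2.1 ∧ pq.2.1 < pq.1.2 ∧ pq.1.2 < pq.2.2).card

/-- `π` is a perfect matching of the finite set `I`: a set of pairs `(i,j)`, `i < j`, with all
endpoints in `I`, pairwise disjoint, covering every element of `I`. -/
def IsPM (I : Finset ℕ) (π : Finset (ℕ × ℕ)) : Prop :=
  (∀ p ∈ π, p.1 ∈ I ∧ p.2 ∈ I ∧ p.1 < p.2) ∧
  (∀ p ∈ π, ∀ q ∈ π, p ≠ q → p.1 ≠ q.1 ∧ p.1 ≠ q.2 ∧ p.2 ≠ q.1 ∧ p.2 ≠ q.2) ∧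
  (∀ k ∈ I, ∃ p ∈ π, k = p.1 ∨ k = p.2)

/-- `pf_I(A)`: the Pfaffian of the submatrix of `A` on rows and columns indexed by `I`,
`pf_I(A) = Σ_π ε(π) Π_{(i,j) ∈ π} a_{ij}` over perfect matchings `π` of `I`
(equal to `1` when `I = ∅`). -/
def pfSub {R : Type*} [CommRing R] (A : ℕ → ℕ → R) (I : Finset ℕ) : R :=
  ∑ π ∈ (I ×ˢ I).powerset.filter (fun π => IsPM I π),
    (-1 : R) ^ crossNum π * ∏ p ∈ π, A p.1 p.2


/-- The generic `2n × 2n` skew-symmetric matrix: above-diagonal entries are independent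
indeterminates `a_{ij} = X (i,j)` for `i < j`. -/
def genA : ℕ → ℕ → MvPolynomial (ℕ × ℕ) ℝ := fun i j =>
  if i < j then MvPolynomial.X (i, j) else if j < i then -MvPolynomial.X (j, i) else 0

/-- The complementary Pfaffian `pf_{I,Ī}(A) = pf_I(A) · pf_Ī(A)` of the generic skew-symmetric
matrix, where `Ī = [2n] ∖ I`. -/
def pfPair (n : ℕ) (I : Finset ℕ) : MvPolynomial (ℕ × ℕ) ℝ :=
  pfSub genA I * pfSub genA (Finset.Icc 1 (2 * n) \ I)

/-- `P_n`: the ℝ-linear span of the complementary Pfaffians `pf_{I,Ī}(A)` over all subsets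
`I ⊆ [2n]` of even cardinality. -/
def Pn (n : ℕ) : Submodule ℝ (MvPolynomial (ℕ × ℕ) ℝ) :=
  Submodule.span ℝ
    {p | ∃ I : Finset ℕ, I ⊆ Finset.Icc 1 (2 * n) ∧ Even I.card ∧ p = pfPair n I}

/-- `(I, Ī)` (with `Ī = [2n] ∖ I`) is a standard partition of `[2n]`: writing
`I = {i_1 < … < i_a}` and `Ī = {j_1 < … < j_b}`, we have `a ≥ b` and `i_k < j_k` for all
`1 ≤ k ≤ b`. -/
def IsStandardPart (n : ℕ) (I : Finset ℕ) : Prop :=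
  I ⊆ Finset.Icc 1 (2 * n) ∧
  (Finset.Icc 1 (2 * n) \ I).card ≤ I.card ∧
  ∀ k < (Finset.Icc 1 (2 * n) \ I).card,
    (I.sort (· ≤ ·)).getD k 0 < ((Finset.Icc 1 (2 * n) \ I).sort (· ≤ ·)).getD k 0

namespace StdPf
open Finset

def isCl (I : Finset ℕ) (M : Finset (ℕ × ℕ)) : Prop := ∀ p ∈ M, (p.1 ∈ I ↔ p.2 ∈ I)

def PMs (N : Finset ℕ) : Finset (Finset (ℕ × ℕ)) :=
  (N ×ˢ N).powerset.filter (fun π => IsPM N π)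

def fI (I : Finset ℕ) (M : Finset (ℕ × ℕ)) : ℝ := if isCl I M then 1 else 0

def mon (M : Finset (ℕ × ℕ)) : MvPolynomial (ℕ × ℕ) ℝ := ∏ p ∈ M, MvPolynomial.X p

def G (N I : Finset ℕ) : MvPolynomial (ℕ × ℕ) ℝ :=
  ∑ M ∈ PMs N, (fI I M * (-1) ^ crossNum M) • mon M

lemma mem_PMs {N : Finset ℕ} {M : Finset (ℕ × ℕ)} : M ∈ PMs N ↔ IsPM N M := by
  unfold PMs
  rw [mem_filter, mem_powerset]
  constructor
  · exact fun h => h.2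
  · intro h
    refine ⟨fun p hp => ?_, h⟩
    have := h.1 p hp
    simp [this.1, this.2.1]

lemma pfSub_genA (I : Finset ℕ) :
    pfSub genA I = ∑ π ∈ PMs I, ((-1 : ℝ) ^ crossNum π) • mon π := by
  unfold pfSub
  apply sum_congr rfl
  intro π hπ
  have h := (mem_PMs.1 hπ).1
  rw [MvPolynomial.smul_eq_C_mul]
  simp only [map_pow, map_neg, map_one]
  congr 1
  apply prod_congr rfl
  intro p hp
  simp [genA, (h p hp).2.2]

/-- crossing indicator -/
def ic (p q : ℕ × ℕ) : ℕ := if p.1 < q.1 ∧ q.1 < p.2 ∧ p.2 < q.2 then 1 else 0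

def lt01 (u v : ℕ) : ℕ := if v < u then 1 else 0

def inv (I J : Finset ℕ) : ℕ := ∑ u ∈ I, ∑ v ∈ J, lt01 u v

lemma crossNum_eq (π : Finset (ℕ × ℕ)) : crossNum π = ∑ p ∈ π, ∑ q ∈ π, ic p q := by
  unfold crossNum ic
  rw [card_filter, sum_product]

lemma pm_sum {I : Finset ℕ} {π : Finset (ℕ × ℕ)} (h : IsPM I π) (g : ℕ → ℕ) :
    ∑ p ∈ π, (g p.1 + g p.2) = ∑ u ∈ I, g u := by
  have hI : I = π.biUnion (fun p => {p.1, p.2}) := by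
    ext k
    simp only [mem_biUnion, mem_insert, mem_singleton]
    constructor
    · exact h.2.2 k
    · rintro ⟨p, hp, rfl | rfl⟩
      · exact (h.1 p hp).1
      · exact (h.1 p hp).2.1
  rw [hI, sum_biUnion]
  · apply sum_congr rfl
    intro p hp
    rw [sum_pair (h.1 p hp).2.2.ne]
  · intro p hp q hq hpq
    have := h.2.1 p hp q hq hpq
    simp only [Function.onFun]
    rw [Finset.disjoint_left]
    simp only [mem_insert, mem_singleton]
    omega

lemma ic_parity (p q : ℕ × ℕ) (hp : p.1 < p.2) (hq : q.1 < q.2)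
    (h : p.1 ≠ q.1 ∧ p.1 ≠ q.2 ∧ p.2 ≠ q.1 ∧ p.2 ≠ q.2) :
    (ic p q + ic q p) % 2 =
      ((lt01 p.1 q.1 + lt01 p.1 q.2) + (lt01 p.2 q.1 + lt01 p.2 q.2)) % 2 := by
  unfold ic lt01
  split_ifs <;> omega

lemma sum_mod_congr {α : Type*} (s : Finset α) (f g : α → ℕ)
    (h : ∀ x ∈ s, f x % 2 = g x % 2) : (∑ x ∈ s, f x) % 2 = (∑ x ∈ s, g x) % 2 := by
  rw [sum_nat_mod, sum_nat_mod s 2 g]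
  congr 1
  exact sum_congr rfl h

lemma cross_parity {I J : Finset ℕ} (hIJ : Disjoint I J) {π₁ π₂ : Finset (ℕ × ℕ)}
    (h₁ : IsPM I π₁) (h₂ : IsPM J π₂) :
    (crossNum (π₁ ∪ π₂)) % 2 = (crossNum π₁ + crossNum π₂ + inv I J) % 2 := by
  have hd : Disjoint π₁ π₂ := by
    rw [Finset.disjoint_left]
    intro p hp hq
    exact Finset.disjoint_left.1 hIJ (h₁.1 p hp).1 (h₂.1 p hq).1
  have e1 : inv I J = ∑ p ∈ π₁, ∑ q ∈ π₂,
      ((lt01 p.1 q.1 + lt01 p.1 q.2) + (lt01 p.2 q.1 + lt01 p.2 q.2)) := by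
    unfold inv
    rw [← pm_sum h₁]
    apply sum_congr rfl
    intro p _
    rw [← pm_sum h₂, ← pm_sum h₂, ← sum_add_distrib]
  have e2 : (∑ p ∈ π₁, ∑ q ∈ π₂, (ic p q + ic q p)) % 2 = inv I J % 2 := by
    rw [e1]
    apply sum_mod_congr
    intro p hp
    apply sum_mod_congr
    intro q hq
    have hp' := h₁.1 p hp
    have hq' := h₂.1 q hq
    have dj : ∀ a ∈ I, ∀ b ∈ J, a ≠ b := fun a ha b hb hab =>
      Finset.disjoint_left.1 hIJ ha (hab ▸ hb)
    exact ic_parity p q hp'.2.2 hq'.2.2 ⟨dj _ hp'.1 _ hq'.1, dj _ hp'.1 _ hq'.2.1,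
      dj _ hp'.2.1 _ hq'.1, dj _ hp'.2.1 _ hq'.2.1⟩
  have e3 : crossNum (π₁ ∪ π₂) = crossNum π₁ + crossNum π₂ +
      ∑ p ∈ π₁, ∑ q ∈ π₂, (ic p q + ic q p) := by
    rw [crossNum_eq, crossNum_eq, crossNum_eq, sum_union hd]
    simp only [sum_union hd, sum_add_distrib]
    rw [sum_comm (s := π₂) (t := π₁)]
    ring
  omega

lemma isPM_union {I J : Finset ℕ} (hIJ : Disjoint I J) {π₁ π₂ : Finset (ℕ × ℕ)}
    (h₁ : IsPM I π₁) (h₂ : IsPM J π₂) : IsPM (I ∪ J) (π₁ ∪ π₂) := by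
  have dj : ∀ a ∈ I, ∀ b ∈ J, a ≠ b := fun a ha b hb hab =>
      Finset.disjoint_left.1 hIJ ha (hab ▸ hb)
  refine ⟨?_, ?_, ?_⟩
  · intro p hp
    rcases mem_union.1 hp with hp | hp
    · have := h₁.1 p hp; simp [this]
    · have := h₂.1 p hp; simp [this]
  · intro p hp q hq hpq
    rcases mem_union.1 hp with hp | hp <;> rcases mem_union.1 hq with hq | hq
    · exact h₁.2.1 p hp q hq hpq
    · have hp' := h₁.1 p hp
      have hq' := h₂.1 q hq
      exact ⟨dj _ hp'.1 _ hq'.1, dj _ hp'.1 _ hq'.2.1,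
        dj _ hp'.2.1 _ hq'.1, dj _ hp'.2.1 _ hq'.2.1⟩
    · have hp' := h₂.1 p hp
      have hq' := h₁.1 q hq
      exact ⟨(dj _ hq'.1 _ hp'.1).symm, (dj _ hq'.2.1 _ hp'.1).symm,
        (dj _ hq'.1 _ hp'.2.1).symm, (dj _ hq'.2.1 _ hp'.2.1).symm⟩
    · exact h₂.2.1 p hp q hq hpq
  · intro k hk
    rcases mem_union.1 hk with hk | hk
    · obtain ⟨p, hp, h⟩ := h₁.2.2 k hk
      exact ⟨p, mem_union_left _ hp, h⟩
    · obtain ⟨p, hp, h⟩ := h₂.2.2 k hk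
      exact ⟨p, mem_union_right _ hp, h⟩

lemma isPM_filter {N I : Finset ℕ} {M : Finset (ℕ × ℕ)} (h : IsPM N M) (hc : isCl I M)
    (hI : I ⊆ N) : IsPM I (M.filter (fun p => p.1 ∈ I)) := by
  refine ⟨?_, ?_, ?_⟩
  · intro p hp
    rw [mem_filter] at hp
    exact ⟨hp.2, (hc p hp.1).1 hp.2, (h.1 p hp.1).2.2⟩
  · intro p hp q hq hpq
    exact h.2.1 p (mem_filter.1 hp).1 q (mem_filter.1 hq).1 hpq
  · intro k hk
    obtain ⟨p, hp, hkp⟩ := h.2.2 k (hI hk)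
    refine ⟨p, mem_filter.2 ⟨hp, ?_⟩, hkp⟩
    rcases hkp with rfl | rfl
    · exact hk
    · exact (hc p hp).2 hk

lemma isCl_compl {N I : Finset ℕ} {M : Finset (ℕ × ℕ)} (h : IsPM N M) :
    isCl (N \ I) M ↔ isCl I M := by
  unfold isCl
  refine forall₂_congr fun p hp => ?_
  have := h.1 p hp
  simp only [mem_sdiff, this.1, this.2.1, true_and]
  tauto

lemma fI_compl {N I : Finset ℕ} {M : Finset (ℕ × ℕ)} (h : IsPM N M) :
    fI (N \ I) M = fI I M := by
  unfold fI
  simp only [isCl_compl h]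

lemma G_compl (N I : Finset ℕ) : G N (N \ I) = G N I := by
  unfold G
  apply sum_congr rfl
  intro M hM
  rw [fI_compl (mem_PMs.1 hM)]

lemma pair_eq {N I : Finset ℕ} (hI : I ⊆ N) :
    pfSub genA I * pfSub genA (N \ I) = ((-1 : ℝ) ^ inv I (N \ I)) • G N I := by
  have hIJ : Disjoint I (N \ I) := disjoint_sdiff
  have hU : I ∪ (N \ I) = N := union_sdiff_of_subset hI
  have hG : G N I = ∑ M ∈ (PMs N).filter (isCl I), ((-1 : ℝ) ^ crossNum M) • mon M := by
    unfold G
    rw [sum_filter]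
    apply sum_congr rfl
    intro M _
    unfold fI
    split_ifs <;> simp
  rw [pfSub_genA, pfSub_genA, sum_mul_sum, hG, smul_sum, ← sum_product']
  refine sum_bij' (fun x _ => x.1 ∪ x.2)
    (fun M _ => (M.filter (fun p => p.1 ∈ I), M.filter (fun p => p.1 ∈ N \ I))) ?_ ?_ ?_ ?_ ?_
  · rintro ⟨π₁, π₂⟩ hx
    rw [mem_product] at hx
    have h₁ := mem_PMs.1 hx.1
    have h₂ := mem_PMs.1 hx.2
    simp only at h₁ h₂
    rw [mem_filter]
    refine ⟨mem_PMs.2 ?_, ?_⟩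
    · have := isPM_union hIJ h₁ h₂
      rwa [hU] at this
    · intro p hp
      rcases mem_union.1 hp with hp | hp
      · have := h₁.1 p hp; simp [this]
      · have := h₂.1 p hp
        simp only [mem_sdiff] at this
        tauto
  · intro M hM
    rw [mem_filter] at hM
    have h := mem_PMs.1 hM.1
    rw [mem_product]
    exact ⟨mem_PMs.2 (isPM_filter h hM.2 hI),
      mem_PMs.2 (isPM_filter h ((isCl_compl h).2 hM.2) sdiff_subset)⟩
  · rintro ⟨π₁, π₂⟩ hx
    rw [mem_product] at hx
    have h₁ := mem_PMs.1 hx.1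
    have h₂ := mem_PMs.1 hx.2
    simp only at h₁ h₂
    have a1 : ∀ p ∈ π₁, p.1 ∈ I := fun p hp => (h₁.1 p hp).1
    have a2 : ∀ p ∈ π₂, p.1 ∈ N ∧ p.1 ∉ I := fun p hp => mem_sdiff.1 (h₂.1 p hp).1
    simp only [Prod.mk.injEq]
    constructor
    · ext p
      simp only [mem_filter, mem_union]
      constructor
      · rintro ⟨h | h, h'⟩
        · exact h
        · exact absurd h' (a2 p h).2
      · exact fun h => ⟨Or.inl h, a1 p h⟩
    · ext p
      simp only [mem_filter, mem_union, mem_sdiff]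
      constructor
      · rintro ⟨h | h, h'⟩
        · exact absurd (a1 p h) h'.2
        · exact h
      · exact fun h => ⟨Or.inr h, a2 p h⟩
  · intro M hM
    rw [mem_filter] at hM
    have h := mem_PMs.1 hM.1
    ext p
    simp only [mem_filter, mem_union, mem_sdiff]
    constructor
    · rintro (h | h) <;> exact h.1
    · intro hp
      have := (h.1 p hp).1
      by_cases hpI : p.1 ∈ I
      · exact Or.inl ⟨hp, hpI⟩
      · exact Or.inr ⟨hp, this, hpI⟩
  · rintro ⟨π₁, π₂⟩ hx
    rw [mem_product] at hx
    have h₁ := mem_PMs.1 hx.1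
    have h₂ := mem_PMs.1 hx.2
    simp only at h₁ h₂
    have hd : Disjoint π₁ π₂ := by
      rw [Finset.disjoint_left]
      intro p hp hq
      exact Finset.disjoint_left.1 hIJ (h₁.1 p hp).1 (h₂.1 p hq).1
    have hm : mon (π₁ ∪ π₂) = mon π₁ * mon π₂ := by
      unfold mon
      rw [prod_union hd]
    have hp := cross_parity hIJ h₁ h₂
    have hs : (-1 : ℝ) ^ inv I (N \ I) * (-1 : ℝ) ^ crossNum (π₁ ∪ π₂) =
        (-1 : ℝ) ^ crossNum π₁ * (-1 : ℝ) ^ crossNum π₂ := by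
      rw [← pow_add, ← pow_add]
      apply neg_one_pow_congr
      rw [Nat.even_iff, Nat.even_iff]
      omega
    simp only
    rw [smul_smul, hs, hm, smul_mul_smul_comm]

lemma exists_mate {N : Finset ℕ} {M : Finset (ℕ × ℕ)} (h : IsPM N M) :
    ∃ m : ℕ → ℕ, (∀ k ∈ N, m k ∈ N) ∧ (∀ k ∈ N, m k ≠ k) ∧ (∀ k ∈ N, m (m k) = k) ∧
      (∀ I, isCl I M ↔ ∀ k ∈ N, (k ∈ I ↔ m k ∈ I)) := by
  have ex : ∀ k ∈ N, ∃ l, (k, l) ∈ M ∨ (l, k) ∈ M := by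
    intro k hk
    obtain ⟨⟨a, b⟩, hp, rfl | rfl⟩ := h.2.2 k hk
    · exact ⟨b, Or.inl hp⟩
    · exact ⟨a, Or.inr hp⟩
  choose! m hm using ex
  have uniq : ∀ k l l', ((k, l) ∈ M ∨ (l, k) ∈ M) → ((k, l') ∈ M ∨ (l', k) ∈ M) → l = l' := by
    intro k l l' h1 h2
    by_contra hne
    rcases h1 with h1 | h1 <;> rcases h2 with h2 | h2
    · exact (h.2.1 _ h1 _ h2 (by simp [hne])).1 rfl
    · have a1 := (h.1 _ h1).2.2
      have a2 := (h.1 _ h2).2.2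
      simp only at a1 a2
      refine (h.2.1 _ h1 _ h2 ?_).2.1 rfl
      simp only [ne_eq, Prod.mk.injEq]
      omega
    · have a1 := (h.1 _ h1).2.2
      have a2 := (h.1 _ h2).2.2
      simp only at a1 a2
      refine (h.2.1 _ h1 _ h2 ?_).2.2.1 rfl
      simp only [ne_eq, Prod.mk.injEq]
      omega
    · exact (h.2.1 _ h1 _ h2 (by simp [hne])).2.2.2 rfl
  have hN : ∀ k ∈ N, m k ∈ N := by
    intro k hk
    rcases hm k hk with h1 | h1
    · exact (h.1 _ h1).2.1
    · exact (h.1 _ h1).1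
  refine ⟨m, hN, ?_, ?_, ?_⟩
  · intro k hk
    rcases hm k hk with h1 | h1
    · exact (h.1 _ h1).2.2.ne'
    · exact (h.1 _ h1).2.2.ne
  · intro k hk
    exact uniq (m k) _ _ (hm _ (hN k hk)) (hm k hk).symm
  · intro I
    constructor
    · intro hc k hk
      rcases hm k hk with h1 | h1
      · exact hc _ h1
      · exact (hc _ h1).symm
    · rintro hc ⟨a, b⟩ hp
      have ha : a ∈ N := (h.1 _ hp).1
      have : m a = b := uniq a _ _ (hm a ha) (Or.inl hp)
      have := hc a ha
      simp_all

lemma f_rel {N J : Finset ℕ} {M : Finset (ℕ × ℕ)} (h : IsPM N M) (hJ : J ⊆ N) :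
    ∑ i ∈ J, fI (J.erase i) M = ∑ i ∈ N \ J, fI (insert i J) M := by
  obtain ⟨m, hmN, hne, hmm, hcl⟩ := exists_mate h
  unfold fI
  rw [← sum_filter, ← sum_filter]
  simp only [hcl]
  refine sum_bij' (fun i _ => m i) (fun i _ => m i) ?_ ?_ ?_ ?_ ?_
  · intro i hi
    rw [mem_filter] at hi
    obtain ⟨hi, hc⟩ := hi
    have hiN := hJ hi
    have h1 := hc i hiN
    have h2 := hne i hiN
    simp only [mem_erase, ne_eq, not_true_eq_false, false_and, h2, not_false_eq_true, true_and,
      false_iff] at h1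
    simp only [mem_filter, mem_sdiff]
    refine ⟨⟨hmN i hiN, h1⟩, ?_⟩
    intro k hk
    have h3 := hc k hk
    have h4 := hmm k hk
    have h5 := hmm i hiN
    simp only [mem_erase, mem_insert] at h3 ⊢
    by_cases e1 : k = i
    · subst e1; simp [hi]
    · by_cases e2 : k = m i
      · subst e2; simp [h5, hi]
      · have e3 : m k ≠ i := fun e => e2 (by rw [← e, h4])
        have e4 : m k ≠ m i := fun e => e1 (by rw [← h4, e, h5])
        simpa [e1, e2, e3, e4] using h3
  · intro i hi
    rw [mem_filter, mem_sdiff] at hi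
    obtain ⟨⟨hiN, hi⟩, hc⟩ := hi
    have h1 := hc i hiN
    have h2 := hne i hiN
    simp only [mem_insert, true_or, h2, false_or, true_iff] at h1
    simp only [mem_filter]
    refine ⟨h1, ?_⟩
    intro k hk
    have h3 := hc k hk
    have h4 := hmm k hk
    have h5 := hmm i hiN
    simp only [mem_erase, mem_insert] at h3 ⊢
    by_cases e1 : k = i
    · subst e1; simp [hi]
    · by_cases e2 : k = m i
      · subst e2; simp [h5, hi]
      · have e3 : m k ≠ i := fun e => e2 (by rw [← e, h4])
        have e4 : m k ≠ m i := fun e => e1 (by rw [← h4, e, h5])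
        simpa [e1, e2, e3, e4] using h3
  · intro i hi
    exact hmm i (hJ (mem_filter.1 hi).1)
  · intro i hi
    exact hmm i (mem_sdiff.1 (mem_filter.1 hi).1).1
  · intros; rfl

lemma G_rel {N J : Finset ℕ} (hJ : J ⊆ N) :
    ∑ i ∈ J, G N (J.erase i) = ∑ i ∈ N \ J, G N (insert i J) := by
  unfold G
  rw [sum_comm, sum_comm (s := N \ J)]
  apply sum_congr rfl
  intro M hM
  rw [← sum_smul, ← sum_smul, ← sum_mul, ← sum_mul, f_rel (mem_PMs.1 hM) hJ]

/-- Coefficients inverting the inclusion matrix. -/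
def cc (k d : ℕ) : ℝ := (-1) ^ (k - 1 + d) / (k * (k - 1).choose d)

lemma cc_top (k : ℕ) (hk : 0 < k) : (k : ℝ) * cc k (k - 1) = 1 := by
  unfold cc
  have : (k : ℝ) ≠ 0 := by positivity
  rw [Nat.choose_self, ← two_mul, pow_mul]
  simp [this]

lemma cc_rec (k e : ℕ) (hk : e + 1 < k) :
    ((e : ℝ) + 1) * cc k e + ((k : ℝ) - (e + 1)) * cc k (e + 1) = 0 := by
  unfold cc
  have hk0 : (k : ℝ) ≠ 0 := by
    have : 0 < k := by omega
    positivity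
  have c1 : ((k - 1).choose e : ℝ) ≠ 0 := by
    exact_mod_cast (Nat.choose_pos (by omega)).ne'
  have c2 : ((k - 1).choose (e + 1) : ℝ) ≠ 0 := by
    exact_mod_cast (Nat.choose_pos (by omega)).ne'
  have h := Nat.choose_succ_right_eq (k - 1) e
  have h' : ((k - 1).choose (e + 1) : ℝ) * (e + 1) = (k - 1).choose e * ((k : ℝ) - (e + 1)) := by
    have e1 : ((k - 1 - e : ℕ) : ℝ) = (k : ℝ) - (e + 1) := by
      rw [Nat.sub_sub, Nat.cast_sub (by omega)]
      push_cast
      ring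
    rw [← e1]
    exact_mod_cast h
  rw [← add_assoc, pow_succ]
  field_simp
  linear_combination ((-1 : ℝ) ^ (k - 1) * (-1 : ℝ) ^ e) * h'

lemma cc_sum {P T D : Finset ℕ} (hT : T ⊆ P) (hD : D ⊆ P) (hDT : D.card = T.card)
    (hlt : (P \ T).card < T.card) :
    ∑ i ∈ D, cc T.card ((D.erase i) ∩ T).card = if D = T then 1 else 0 := by
  have hsplit : ∑ i ∈ D, cc T.card ((D.erase i) ∩ T).card =
      ((D ∩ T).card : ℝ) * cc T.card ((D ∩ T).card - 1) +
      ((D \ T).card : ℝ) * cc T.card (D ∩ T).card := by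
    rw [← sum_inter_add_sum_sdiff D T]
    congr 1
    · rw [sum_congr rfl (g := fun _ => cc T.card ((D ∩ T).card - 1)), sum_const, nsmul_eq_mul]
      intro i hi
      rw [erase_inter, card_erase_of_mem hi]
    · rw [sum_congr rfl (g := fun _ => cc T.card ((D ∩ T).card)), sum_const, nsmul_eq_mul]
      intro i hi
      rw [erase_inter, erase_eq_of_notMem]
      intro h
      exact (mem_sdiff.1 hi).2 (mem_inter.1 h).2
  rw [hsplit]
  have hc : (D \ T).card + (D ∩ T).card = D.card := card_sdiff_add_card_inter D T
  have hle : (D \ T).card ≤ (P \ T).card := card_le_card (sdiff_subset_sdiff hD le_rfl)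
  by_cases h : D = T
  · subst h
    simp only [inter_self, sdiff_self, if_true]
    rw [cc_top _ (by omega)]
    simp
  · rw [if_neg h]
    have hlt2 : (D ∩ T).card < T.card := by
      by_contra hge
      have h0 : (D \ T).card = 0 := by omega
      rw [card_eq_zero, sdiff_eq_empty_iff_subset] at h0
      exact h (eq_of_subset_of_card_le h0 hDT.ge)
    obtain ⟨e, he⟩ : ∃ e, (D ∩ T).card = e + 1 := ⟨(D ∩ T).card - 1, by omega⟩
    have h2 : ((D \ T).card : ℝ) = (T.card : ℝ) - (e + 1) := by
      have : (D \ T).card + (e + 1) = T.card := by omega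
      have : ((D \ T).card : ℝ) + (e + 1) = T.card := by exact_mod_cast this
      linarith
    rw [h2, he]
    have := cc_rec T.card e (by omega)
    simpa using this

lemma swap_sum {V : Type*} [AddCommMonoid V] (P : Finset ℕ) (k : ℕ)
    (F : Finset ℕ → Finset ℕ → V) :
    ∑ C ∈ powersetCard k P, ∑ i ∈ P \ C, F C (insert i C) =
    ∑ D ∈ powersetCard (k + 1) P, ∑ i ∈ D, F (D.erase i) D := by
  rw [sum_sigma', sum_sigma']
  refine sum_bij' (fun x _ => ⟨insert x.2 x.1, x.2⟩) (fun x _ => ⟨x.1.erase x.2, x.2⟩) ?_ ?_ ?_ ?_ ?_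
  · rintro ⟨C, i⟩ hx
    simp only [mem_sigma, mem_powersetCard, mem_sdiff] at hx ⊢
    refine ⟨⟨?_, ?_⟩, mem_insert_self _ _⟩
    · exact insert_subset hx.2.1 hx.1.1
    · rw [card_insert_of_notMem hx.2.2, hx.1.2]
  · rintro ⟨D, i⟩ hx
    simp only [mem_sigma, mem_powersetCard, mem_sdiff] at hx ⊢
    refine ⟨⟨?_, ?_⟩, hx.1.1 hx.2, notMem_erase _ _⟩
    · exact (erase_subset _ _).trans hx.1.1
    · rw [card_erase_of_mem hx.2, hx.1.2]; rfl
  · rintro ⟨C, i⟩ hx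
    simp only [mem_sigma, mem_powersetCard, mem_sdiff] at hx ⊢
    simp only [erase_insert hx.2.2]
  · rintro ⟨D, i⟩ hx
    simp only [mem_sigma, mem_powersetCard, mem_sdiff] at hx ⊢
    simp only [insert_erase hx.2]
  · rintro ⟨C, i⟩ hx
    simp only [mem_sigma, mem_powersetCard, mem_sdiff] at hx ⊢
    simp only [erase_insert hx.2.2]

lemma straighten {N P B : Finset ℕ} (hP : P ⊆ N) (hB : B ⊆ N)
    (hlt : (P \ B).card < (P ∩ B).card) :
    G N B = ∑ C ∈ powersetCard ((P ∩ B).card - 1) P,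
      cc (P ∩ B).card (C ∩ (P ∩ B)).card •
      (∑ i ∈ C ∪ (B \ P), G N ((C ∪ (B \ P)).erase i) -
        ∑ i ∈ (N \ P) \ (B \ P), G N (insert i (C ∪ (B \ P)))) := by
  set T := P ∩ B with hTdef
  set B' := B \ P with hB'
  have hTP : T ⊆ P := inter_subset_left
  have hPT : P \ T = P \ B := by
    rw [hTdef, sdiff_inter_self_left]
  obtain ⟨k, hk⟩ : ∃ k, T.card = k + 1 := ⟨T.card - 1, by omega⟩
  have hB'P : Disjoint B' P := sdiff_disjoint
  have hTB : T ∪ B' = B := by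
    rw [hTdef, hB', inter_comm, union_comm, sdiff_union_inter]
  have step : ∀ C ∈ powersetCard (T.card - 1) P,
      (∑ i ∈ C ∪ B', G N ((C ∪ B').erase i) - ∑ i ∈ (N \ P) \ B', G N (insert i (C ∪ B'))) =
        ∑ i ∈ P \ C, G N (insert i C ∪ B') := by
    intro C hC
    have hCP := (mem_powersetCard.1 hC).1
    have hJ : C ∪ B' ⊆ N := union_subset (hCP.trans hP) (sdiff_subset.trans hB)
    rw [G_rel hJ, sub_eq_iff_eq_add]
    have hd : Disjoint (P \ C) ((N \ P) \ B') := by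
      rw [Finset.disjoint_left]
      intro x h1 h2
      simp only [mem_sdiff] at h1 h2
      exact h2.1.2 h1.1
    have hu : N \ (C ∪ B') = (P \ C) ∪ ((N \ P) \ B') := by
      ext x
      have h1 := @hCP x
      have h2 := @hP x
      have h3 : x ∈ B' → x ∉ P := fun h => Finset.disjoint_left.1 hB'P h
      simp only [mem_sdiff, mem_union]
      tauto
    rw [hu, sum_union hd]
    simp only [insert_union]
  rw [sum_congr rfl (fun C hC => by rw [step C hC])]
  simp only [smul_sum]
  rw [swap_sum P (T.card - 1) (fun C D => cc T.card (C ∩ T).card • G N (D ∪ B'))]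
  have : T.card - 1 + 1 = T.card := by omega
  rw [this]
  have e : ∀ D ∈ powersetCard T.card P,
      ∑ i ∈ D, cc T.card ((D.erase i) ∩ T).card • G N (D ∪ B') =
        if D = T then G N (D ∪ B') else 0 := by
    intro D hD
    rw [mem_powersetCard] at hD
    rw [← sum_smul, cc_sum hTP hD.1 hD.2 (by rw [hPT]; exact hlt)]
    split_ifs <;> simp
  rw [sum_congr rfl e, sum_ite_eq', if_pos, hTB]
  rw [mem_powersetCard]
  exact ⟨hTP, rfl⟩

lemma span_main {N : Finset ℕ} (S : Submodule ℝ (MvPolynomial (ℕ × ℕ) ℝ)) (hN : Even N.card)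
    (hS : ∀ B, B ⊆ N → Even B.card → B.card ≤ (N \ B).card →
      (∀ m, (N.filter (· ≤ m) ∩ B).card ≤ (N.filter (· ≤ m) \ B).card) → G N B ∈ S) :
    ∀ b d B, B ⊆ N → Even B.card → B.card = b →
      2 ^ (N.sup id + 1) - ∑ i ∈ B, 2 ^ i = d → G N B ∈ S := by
  intro b
  induction b using Nat.strong_induction_on with
  | _ b ihb =>
  intro d
  induction d using Nat.strong_induction_on with
  | _ d ihd =>
  intro B hB hev hb hd
  have hcN := card_sdiff_add_card_eq_card hB
  by_cases hle : B.card ≤ (N \ B).card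
  swap
  · rw [← G_compl]
    refine ihb (N \ B).card (by omega) _ _ sdiff_subset ?_ rfl rfl
    rw [← hcN] at hN
    exact (Nat.even_add.1 hN).2 hev
  by_cases hst : ∀ m, (N.filter (· ≤ m) ∩ B).card ≤ (N.filter (· ≤ m) \ B).card
  · exact hS B hB hev hle hst
  push Not at hst
  obtain ⟨m, hm⟩ := hst
  set P := N.filter (· ≤ m) with hPdef
  have hP : P ⊆ N := filter_subset _ _
  rw [straighten hP hB hm]
  refine S.sum_mem fun C hC => S.smul_mem _ (S.sub_mem ?_ ?_)
  all_goals
    rw [mem_powersetCard] at hC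
    have hdj : Disjoint C (B \ P) :=
      Finset.disjoint_left.2 fun x h1 h2 => (mem_sdiff.1 h2).2 (hC.1 h1)
    have hJc : (C ∪ B \ P).card + 1 = b := by
      rw [card_union_of_disjoint hdj, hC.2]
      have := card_sdiff_add_card_inter B P
      rw [inter_comm] at this
      omega
    have hJN : C ∪ B \ P ⊆ N := union_subset (hC.1.trans hP) (sdiff_subset.trans hB)
  · refine S.sum_mem fun i hi => ?_
    have hc : ((C ∪ B \ P).erase i).card + 2 = b := by
      rw [card_erase_of_mem hi]
      have : 0 < (C ∪ B \ P).card := card_pos.2 ⟨i, hi⟩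
      omega
    refine ihb _ (by omega) _ _ ((erase_subset _ _).trans hJN) ?_ rfl rfl
    rw [hb, ← hc] at hev
    rw [Nat.even_iff] at hev ⊢
    omega
  · refine S.sum_mem fun i hi => ?_
    simp only [mem_sdiff] at hi
    have hiJ : i ∉ C ∪ B \ P := by
      simp only [mem_union, mem_sdiff]
      have := @hC.1 i
      tauto
    have hc : (insert i (C ∪ B \ P)).card = b := by
      rw [card_insert_of_notMem hiJ, hJc]
    have hsub : insert i (C ∪ B \ P) ⊆ N := insert_subset hi.1.1 hJN
    refine ihd _ ?_ _ hsub (by rw [hc, ← hb]; exact hev) hc rfl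
    have him : m < i := by
      have h2 := hi.1.2
      rw [hPdef, mem_filter] at h2
      by_contra h3
      exact h2 ⟨hi.1.1, by omega⟩
    have bound : ∑ j ∈ insert i (C ∪ B \ P), 2 ^ j < 2 ^ (N.sup id + 1) := by
      apply Nat.geomSum_lt le_rfl
      intro j hj
      have : j ≤ N.sup id := Finset.le_sup (f := id) (hsub hj)
      omega
    have e1 : ∑ j ∈ insert i (C ∪ B \ P), 2 ^ j =
        2 ^ i + (∑ j ∈ C, 2 ^ j + ∑ j ∈ B \ P, 2 ^ j) := by
      rw [sum_insert hiJ, sum_union hdj]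
    have e2 : ∑ j ∈ B, 2 ^ j = ∑ j ∈ B ∩ P, 2 ^ j + ∑ j ∈ B \ P, 2 ^ j := by
      rw [sum_inter_add_sum_sdiff]
    have e3 : ∑ j ∈ B ∩ P, 2 ^ j < 2 ^ i := by
      apply Nat.geomSum_lt le_rfl
      intro j hj
      have := (mem_filter.1 (mem_inter.1 hj).2).2
      omega
    rw [← hd]
    omega

/-- Boolean indicator of membership. -/
def xi (B : Finset ℕ) (a : ℕ) : ℝ := if a ∈ B then 1 else 0

def dl : List ℕ → Finset ℕ → ℝ
  | a :: b :: l, B => (if (a ∈ B ↔ b ∈ B) then 1 else 0) * dl l B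
  | _, _ => 1

def el : List ℕ → List ℕ → Finset ℕ → ℝ
  | a :: la, b :: lb, B => (xi B b - xi B a) * el la lb B
  | _, _, _ => 1

def mt : List ℕ → Finset (ℕ × ℕ)
  | a :: b :: l => insert (min a b, max a b) (mt l)
  | _ => ∅

lemma isPM_insert {I : Finset ℕ} {π : Finset (ℕ × ℕ)} (h : IsPM I π) {a b : ℕ} (hab : a ≠ b)
    (ha : a ∉ I) (hb : b ∉ I) :
    IsPM (insert a (insert b I)) (insert (min a b, max a b) π) := by
  have hs : IsPM {a, b} {(min a b, max a b)} := by
    refine ⟨?_, ?_, ?_⟩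
    · intro p hp
      rw [mem_singleton] at hp
      subst hp
      rcases lt_or_gt_of_ne hab with h | h
      · simp [min_eq_left h.le, max_eq_right h.le, h]
      · simp [min_eq_right h.le, max_eq_left h.le, h]
    · intro p hp q hq hpq
      rw [mem_singleton] at hp hq
      exact absurd (hp.trans hq.symm) hpq
    · intro k hk
      refine ⟨_, mem_singleton_self _, ?_⟩
      simp only [mem_insert, mem_singleton] at hk
      simp only
      omega
  have hd : Disjoint ({a, b} : Finset ℕ) I := by
    simp [Finset.disjoint_left, ha, hb]
  have := isPM_union hd hs h
  simpa [insert_union] using this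

lemma isPM_mt : ∀ l : List ℕ, l.Nodup → Even l.length → IsPM l.toFinset (mt l)
  | [], _, _ => by simp [IsPM, mt]
  | [a], _, h => by simp at h
  | a :: b :: l, hn, h => by
    have ih := isPM_mt l (by simp at hn; tauto) (by
      rw [Nat.even_iff] at h ⊢
      simp at h
      omega)
    simp only [List.nodup_cons, List.mem_cons, not_or] at hn
    have := isPM_insert ih (a := a) (b := b) hn.1.1 (by simp [hn.1.2]) (by simp [hn.2.1])
    simpa [mt] using this

lemma dl_eq : ∀ (l : List ℕ) (B : Finset ℕ), dl l B = fI B (mt l)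
  | [], B => by simp [dl, fI, mt, isCl]
  | [a], B => by simp [dl, fI, mt, isCl]
  | a :: b :: l, B => by
    rw [dl, dl_eq l B]
    rw [mt]
    unfold fI isCl
    rw [forall_mem_insert]
    have : (min a b ∈ B ↔ max a b ∈ B) ↔ (a ∈ B ↔ b ∈ B) := by
      rcases le_total a b with h | h
      · rw [min_eq_left h, max_eq_right h]
      · rw [min_eq_right h, max_eq_left h]
        tauto
    simp only [this]
    by_cases h1 : (a ∈ B ↔ b ∈ B) <;> simp [h1]

lemma four (B : Finset ℕ) (i1 i2 j1 j2 : ℕ) (r : ℝ) :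
    (xi B j1 - xi B i1) * (xi B j2 - xi B i2) * r =
      dl [i1, i2, j1, j2] B * r - dl [i1, j2, j1, i2] B * r := by
  simp only [xi, dl]
  by_cases h1 : i1 ∈ B <;> by_cases h2 : i2 ∈ B <;> by_cases h3 : j1 ∈ B <;>
    by_cases h4 : j2 ∈ B <;> simp [h1, h2, h3, h4]

lemma dl_four (B : Finset ℕ) (a b c d : ℕ) (l : List ℕ) :
    dl (a :: b :: c :: d :: l) B = dl [a, b, c, d] B * dl l B := by
  simp [dl]

lemma functional {ι : Type*} (s : Finset ι) (c : ι → ℝ) (Bs : ι → Finset ℕ) (N : Finset ℕ)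
    (hN : Even N.card)
    (h0 : ∀ M ∈ PMs N, ∑ i ∈ s, c i * fI (Bs i) M = 0) :
    ∀ la lb l : List ℕ, la.length = lb.length → Even la.length →
      ((la ++ lb ++ l : List ℕ) : Multiset ℕ) = N.val →
      ∑ i ∈ s, c i * (el la lb (Bs i) * dl l (Bs i)) = 0
  | [], [], l, _, _, hl => by
    simp only [el, one_mul, List.nil_append] at hl ⊢
    simp only [dl_eq]
    apply h0
    rw [mem_PMs]
    have hnd : l.Nodup := by
      rw [← Multiset.coe_nodup, hl]; exact N.nodup
    have hfs : l.toFinset = N := by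
      ext x
      rw [List.mem_toFinset, ← Multiset.mem_coe, hl, mem_val]
    have hlen : l.length = N.card := by
      rw [← Multiset.coe_card, hl, card_val]
    rw [← hfs]
    exact isPM_mt l hnd (by rw [hlen]; exact hN)
  | [], _ :: _, _, h, _, _ => by simp at h
  | _ :: _, [], _, h, _, _ => by simp at h
  | [_], [_], _, _, h, _ => by simp at h
  | [_], _ :: _ :: _, _, h, _, _ => by simp at h
  | _ :: _ :: _, [_], _, h, _, _ => by simp at h
  | i1 :: i2 :: la, j1 :: j2 :: lb, l, hlen, hev, hl => by
    have hlen' : la.length = lb.length := by simpa using hlen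
    have hev' : Even la.length := by
      rw [Nat.even_iff] at hev ⊢
      simp only [List.length_cons] at hev
      omega
    have r1 := functional s c Bs N hN h0 la lb (i1 :: i2 :: j1 :: j2 :: l) hlen' hev' (by
      rw [← hl, Multiset.coe_eq_coe, List.perm_iff_count]
      intro a
      simp only [List.count_append, List.count_cons]
      omega)
    have r2 := functional s c Bs N hN h0 la lb (i1 :: j2 :: j1 :: i2 :: l) hlen' hev' (by
      rw [← hl, Multiset.coe_eq_coe, List.perm_iff_count]
      intro a
      simp only [List.count_append, List.count_cons]
      omega)
    rw [← sub_zero (0 : ℝ)]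
    nth_rewrite 1 [← r1]
    rw [← r2, ← sum_sub_distrib]
    apply sum_congr rfl
    intro i _
    simp only [dl_four _ _ _ _ _ l, el]
    have := four (Bs i) i1 i2 j1 j2 (el la lb (Bs i) * dl l (Bs i))
    linear_combination c i * this

/-- Number of entries of `l` in `B`. -/
def cnt (B : Finset ℕ) (l : List ℕ) : ℕ := (l.map (fun a => if a ∈ B then 1 else 0)).sum
/-- Sum of entries of `l` in `B`. -/
def sm (B : Finset ℕ) (l : List ℕ) : ℕ := (l.map (fun a => if a ∈ B then a else 0)).sum

lemma el_ne {B : Finset ℕ} {la lb : List ℕ} (h : List.Forall₂ (· < ·) la lb)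
    (hne : el la lb B ≠ 0) :
    cnt B la + cnt B lb = lb.length ∧ sm B la + sm B lb ≤ lb.sum ∧
      (sm B la + sm B lb = lb.sum → ∀ x ∈ lb, x ∈ B) := by
  induction h with
  | nil => simp [cnt, sm]
  | @cons a b la lb hab _ ih =>
    rw [el] at hne
    have h1 := left_ne_zero_of_mul hne
    obtain ⟨i1, i2, i3⟩ := ih (right_ne_zero_of_mul hne)
    unfold cnt sm xi at *
    by_cases ha : a ∈ B <;> by_cases hb : b ∈ B <;>
      simp only [ha, hb, if_true, if_false, sub_self, ne_eq, not_true_eq_false] at h1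
    · simp only [List.map_cons, List.sum_cons, ha, hb, if_true, if_false, List.length_cons]
      refine ⟨by omega, by omega, by omega⟩
    · simp only [List.map_cons, List.sum_cons, ha, hb, if_true, if_false, List.length_cons]
      refine ⟨by omega, by omega, fun he => ?_⟩
      intro x hx
      rcases List.mem_cons.1 hx with rfl | hx
      · exact hb
      · exact i3 (by omega) x hx

lemma el_one {B : Finset ℕ} {la lb : List ℕ} (h : List.Forall₂ (· < ·) la lb)
    (ha : ∀ x ∈ la, x ∉ B) (hb : ∀ x ∈ lb, x ∈ B) : el la lb B = 1 := by
  induction h with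
  | nil => simp [el]
  | cons _ _ ih =>
    simp only [List.mem_cons, forall_eq_or_imp] at ha hb
    rw [el, ih ha.2 hb.2]
    simp [xi, ha.1, hb.1]

lemma dl_one : ∀ (l : List ℕ) (B : Finset ℕ), (∀ x ∈ l, x ∉ B) → dl l B = 1
  | [], B, _ => by simp [dl]
  | [a], B, _ => by simp [dl]
  | a :: b :: l, B, h => by
    simp only [List.mem_cons, forall_eq_or_imp] at h
    rw [dl, dl_one l B h.2.2]
    simp [h.1, h.2.1]

lemma sum_list {N : Finset ℕ} {l : List ℕ} (hl : (l : Multiset ℕ) = N.val) {B : Finset ℕ}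
    (hB : B ⊆ N) (g : ℕ → ℕ) : (l.map (fun a => if a ∈ B then g a else 0)).sum = ∑ a ∈ B, g a := by
  have : ∑ a ∈ N, (if a ∈ B then g a else 0) = ∑ a ∈ B, g a := by
    rw [← sum_filter, filter_mem_eq_inter, inter_eq_right.2 hB]
  rw [← this, Finset.sum, ← hl, Multiset.map_coe, Multiset.sum_coe]

lemma key {N B B' : Finset ℕ} {la lb l : List ℕ} (h : List.Forall₂ (· < ·) la lb)
    (hl : ((la ++ lb ++ l : List ℕ) : Multiset ℕ) = N.val) (hlb : (lb : Multiset ℕ) = B.val)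
    (hB' : B' ⊆ N) (hne : el la lb B' ≠ 0) (hc : B'.card ≤ B.card)
    (hs : B'.card = B.card → ∑ x ∈ B, x ≤ ∑ x ∈ B', x) : B' = B := by
  obtain ⟨h1, h2, h3⟩ := el_ne h hne
  have c1 := sum_list hl hB' (fun _ => 1)
  have c2 := sum_list hl hB' (fun a => a)
  rw [← card_eq_sum_ones] at c1
  simp only [List.map_append, List.sum_append] at c1 c2
  have hlen : lb.length = B.card := by rw [← Multiset.coe_card, hlb, card_val]
  have hsum : lb.sum = ∑ x ∈ B, x := by
    rw [Finset.sum, ← hlb]; simp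
  unfold cnt sm at *
  have hcard : B'.card = B.card := by omega
  have hs' := hs hcard
  have h0 : (l.map (fun a => if a ∈ B' then 1 else 0)).sum = 0 := by omega
  have h0' : (l.map (fun a => if a ∈ B' then a else 0)).sum = 0 := by
    rw [List.sum_eq_zero_iff] at h0 ⊢
    simp only [List.mem_map, forall_exists_index, and_imp, forall_apply_eq_imp_iff₂] at h0 ⊢
    intro a ha
    have := h0 a ha
    by_cases hh : a ∈ B' <;> simp [hh] at this ⊢
  have hsub : B ⊆ B' := by
    intro x hx
    apply h3 (by omega)
    rw [← Multiset.mem_coe, hlb]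
    exact hx
  exact (eq_of_subset_of_card_le hsub hc).symm

lemma coeff_G {N I : Finset ℕ} {M : Finset (ℕ × ℕ)} (hM : M ∈ PMs N) :
    MvPolynomial.coeff (∑ p ∈ M, Finsupp.single p 1) (G N I) = fI I M * (-1) ^ crossNum M := by
  have hmon : ∀ M', mon M' = MvPolynomial.monomial (∑ p ∈ M', Finsupp.single p 1) 1 := by
    intro M'
    unfold mon
    rw [MvPolynomial.monomial_sum_one]
    rfl
  have hinj : ∀ M', (∑ p ∈ M', Finsupp.single p 1 : (ℕ × ℕ) →₀ ℕ) = ∑ p ∈ M, Finsupp.single p 1 →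
      M' = M := by
    intro M' h
    ext p
    have := DFunLike.congr_fun h p
    simp only [Finsupp.finsetSum_apply, Finsupp.single_apply, sum_ite_eq'] at this
    by_cases h1 : p ∈ M' <;> by_cases h2 : p ∈ M <;> simp_all
  unfold G
  rw [MvPolynomial.coeff_sum, sum_eq_single M]
  · rw [MvPolynomial.coeff_smul, hmon, MvPolynomial.coeff_monomial]
    simp
  · intro M' _ hne
    rw [MvPolynomial.coeff_smul, hmon, MvPolynomial.coeff_monomial, if_neg]
    · simp
    · exact fun h => hne (hinj M' h)
  · exact fun h => absurd hM h

/-- Abstract independence. -/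
lemma indep {ι : Type*} (N : Finset ℕ) (hN : Even N.card) (Bs : ι → Finset ℕ)
    (hinj : Function.Injective Bs) (hBN : ∀ i, Bs i ⊆ N) (hev : ∀ i, Even (Bs i).card)
    (hst : ∀ i, ∃ la lb l : List ℕ, List.Forall₂ (· < ·) la lb ∧
      ((la ++ lb ++ l : List ℕ) : Multiset ℕ) = N.val ∧ (lb : Multiset ℕ) = (Bs i).val)
    (s : Finset ι) (c : ι → ℝ) (h0 : ∑ i ∈ s, c i • G N (Bs i) = 0) : ∀ i ∈ s, c i = 0 := by
  have h1 : ∀ M ∈ PMs N, ∑ i ∈ s, c i * fI (Bs i) M = 0 := by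
    intro M hM
    have := congrArg (MvPolynomial.coeff (∑ p ∈ M, Finsupp.single p 1)) h0
    rw [MvPolynomial.coeff_sum] at this
    simp only [MvPolynomial.coeff_smul, coeff_G hM, MvPolynomial.coeff_zero, smul_eq_mul] at this
    simp only [← mul_assoc] at this
    rw [← sum_mul] at this
    exact (mul_eq_zero.1 this).resolve_right (by simp)
  by_contra! hcon
  obtain ⟨i₁, hi₁, hci₁⟩ := hcon
  obtain ⟨i, hi, hmax⟩ := exists_max_image (s.filter (fun i => c i ≠ 0))
    (fun i => toLex ((Bs i).card, OrderDual.toDual (∑ x ∈ Bs i, x)))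
    ⟨i₁, mem_filter.2 ⟨hi₁, hci₁⟩⟩
  rw [mem_filter] at hi
  obtain ⟨la, lb, l, hf, hl, hlb⟩ := hst i
  have hlen : lb.length = (Bs i).card := by rw [← Multiset.coe_card, hlb, card_val]
  have hnd : (la ++ lb ++ l).Nodup := by rw [← Multiset.coe_nodup, hl]; exact N.nodup
  have hmem : ∀ x, x ∈ lb ↔ x ∈ Bs i := by
    intro x
    rw [← Multiset.mem_coe, hlb, mem_val]
  have hz := functional s c Bs N hN h1 la lb l hf.length_eq
    (by rw [hf.length_eq, hlen]; exact hev i) hl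
  rw [sum_eq_single i] at hz
  · rw [el_one hf, dl_one] at hz
    · simp at hz
      exact hi.2 hz
    · intro x hx hxB
      rw [← hmem] at hxB
      rw [List.nodup_append] at hnd
      exact hnd.2.2 x (List.mem_append_right _ hxB) x hx rfl
    · intro x hx hxB
      rw [← hmem] at hxB
      rw [List.append_assoc, List.nodup_append] at hnd
      exact hnd.2.2 x hx x (List.mem_append_left _ hxB) rfl
    · exact fun x hx => (hmem x).1 hx
  · intro j hj hji
    by_cases hcj : c j = 0
    · simp [hcj]
    by_cases hel : el la lb (Bs j) = 0
    · simp [hel]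
    exfalso
    apply hji
    apply hinj
    have hm := hmax j (mem_filter.2 ⟨hj, hcj⟩)
    rw [Prod.Lex.toLex_le_toLex] at hm
    simp only [OrderDual.toDual_le_toDual] at hm
    refine key hf hl hlb (hBN j) hel (by omega) (by omega)
  · exact fun h => absurd hi.1 h

lemma sort_count (s : Finset ℕ) (k m : ℕ) (hk : k < s.card) :
    (s.sort (· ≤ ·)).getD k 0 ≤ m ↔ k < (s.filter (· ≤ m)).card := by
  have hlen : k < (s.sort (· ≤ ·)).length := by rw [length_sort]; exact hk
  have he : (s.sort (· ≤ ·)).getD k 0 = s.orderEmbOfFin rfl ⟨k, hk⟩ := by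
    rw [List.getD_eq_getElem _ _ hlen, orderEmbOfFin_apply]
    rfl
  rw [he]
  set e := s.orderEmbOfFin rfl
  constructor
  · intro h
    have hsub : (Finset.Iic (⟨k, hk⟩ : Fin s.card)).map e.toEmbedding ⊆ s.filter (· ≤ m) := by
      intro x hx
      rw [mem_map] at hx
      obtain ⟨i, hi, rfl⟩ := hx
      rw [mem_filter]
      refine ⟨orderEmbOfFin_mem _ _ _, le_trans ?_ h⟩
      exact e.monotone (mem_Iic.1 hi)
    have := card_le_card hsub
    rw [card_map, Fin.card_Iic] at this
    simpa using this
  · intro h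
    by_contra hlt
    push Not at hlt
    have hsub : s.filter (· ≤ m) ⊆ (Finset.Iio (⟨k, hk⟩ : Fin s.card)).map e.toEmbedding := by
      intro x hx
      rw [mem_filter] at hx
      have hx' : x ∈ Set.range e := by
        rw [range_orderEmbOfFin]; exact hx.1
      obtain ⟨i, rfl⟩ := hx'
      rw [mem_map]
      refine ⟨i, ?_, rfl⟩
      rw [mem_Iio]
      exact e.lt_iff_lt.1 (lt_of_le_of_lt hx.2 hlt)
    have := card_le_card hsub
    rw [card_map, Fin.card_Iio] at this
    simp at this
    omega

lemma getD_mem (s : Finset ℕ) (k : ℕ) (hk : k < s.card) : (s.sort (· ≤ ·)).getD k 0 ∈ s := by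
  have hlen : k < (s.sort (· ≤ ·)).length := by rw [length_sort]; exact hk
  rw [List.getD_eq_getElem _ _ hlen]
  exact (mem_sort (· ≤ ·)).1 (List.getElem_mem hlen)

lemma standard_of_counts {n : ℕ} {B : Finset ℕ} (hB : B ⊆ Finset.Icc 1 (2 * n))
    (hle : B.card ≤ (Finset.Icc 1 (2 * n) \ B).card)
    (h : ∀ m, ((Finset.Icc 1 (2 * n)).filter (· ≤ m) ∩ B).card ≤
      ((Finset.Icc 1 (2 * n)).filter (· ≤ m) \ B).card) :
    IsStandardPart n (Finset.Icc 1 (2 * n) \ B) := by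
  set N := Finset.Icc 1 (2 * n)
  have hBB : N \ (N \ B) = B := by rw [sdiff_sdiff_right_self]; exact inter_eq_right.2 hB
  unfold IsStandardPart
  change N \ B ⊆ N ∧ (N \ (N \ B)).card ≤ (N \ B).card ∧ ∀ k < (N \ (N \ B)).card,
    ((N \ B).sort (· ≤ ·)).getD k 0 < ((N \ (N \ B)).sort (· ≤ ·)).getD k 0
  rw [hBB]
  refine ⟨sdiff_subset, hle, fun k hk => ?_⟩
  have hkA : k < (N \ B).card := by omega
  set m := (B.sort (· ≤ ·)).getD k 0 with hm
  have c1 : k < (B.filter (· ≤ m)).card := (sort_count B k m hk).1 le_rfl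
  have e1 : N.filter (· ≤ m) ∩ B = B.filter (· ≤ m) := by
    ext x
    have := @hB x
    simp only [mem_inter, mem_filter]
    tauto
  have e2 : N.filter (· ≤ m) \ B = (N \ B).filter (· ≤ m) := by
    ext x
    simp only [mem_sdiff, mem_filter]
    tauto
  have h' := h m
  rw [e1, e2] at h'
  have h2 := (sort_count (N \ B) k m hkA).2 (by omega)
  refine lt_of_le_of_ne h2 ?_
  intro he
  have a1 := getD_mem (N \ B) k hkA
  have a2 := getD_mem B k hk
  rw [he] at a1
  exact (mem_sdiff.1 a1).2 a2

lemma lists_of_standard {n : ℕ} {I : Finset ℕ} (h : IsStandardPart n I) :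
    ∃ la lb l : List ℕ, List.Forall₂ (· < ·) la lb ∧
      ((la ++ lb ++ l : List ℕ) : Multiset ℕ) = (Finset.Icc 1 (2 * n)).val ∧
      (lb : Multiset ℕ) = (Finset.Icc 1 (2 * n) \ I).val := by
  obtain ⟨hI, hle, hlt⟩ := h
  set N := Finset.Icc 1 (2 * n)
  set B := N \ I
  refine ⟨(I.sort (· ≤ ·)).take B.card, B.sort (· ≤ ·), (I.sort (· ≤ ·)).drop B.card, ?_, ?_, ?_⟩
  · rw [List.forall₂_iff_get]
    refine ⟨by simp [hle], ?_⟩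
    intro k h1 h2
    have hk : k < B.card := by simpa using h2
    have := hlt k hk
    rw [List.getD_eq_getElem _ _ (by rw [length_sort]; omega), List.getD_eq_getElem _ _ h2] at this
    simpa using this
  · have e : ((I.sort (· ≤ ·)).take B.card ++ B.sort (· ≤ ·) ++
        (I.sort (· ≤ ·)).drop B.card).Perm (I.sort (· ≤ ·) ++ B.sort (· ≤ ·)) := by
      rw [List.append_assoc]
      refine (List.Perm.append_left _ List.perm_append_comm).trans ?_
      rw [← List.append_assoc, List.take_append_drop]
    rw [Multiset.coe_eq_coe.2 e, ← Multiset.coe_add, sort_eq, sort_eq]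
    have hd : Disjoint I B := disjoint_sdiff
    have hU : I.disjUnion B hd = N := by
      rw [disjUnion_eq_union]; exact union_sdiff_of_subset hI
    rw [← hU]
    rfl
  · exact sort_eq _ _

lemma pfPair_eq {n : ℕ} {I : Finset ℕ} (hI : I ⊆ Finset.Icc 1 (2 * n)) :
    pfPair n I = ((-1 : ℝ) ^ inv I (Finset.Icc 1 (2 * n) \ I)) •
      G (Finset.Icc 1 (2 * n)) (Finset.Icc 1 (2 * n) \ I) := by
  rw [G_compl]
  exact pair_eq hI

end StdPf

/-- The standard complementary Pfaffians (indexed by standard partitions `(I,Ī)` of `[2n]` with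
both parts of even size) form an ℝ-basis of `P_n`: they are linearly independent and they
span `P_n`. -/
theorem standard_pfaffians_basis (n : ℕ) (hn : 1 ≤ n) :
    LinearIndependent ℝ
      (fun I : {I : Finset ℕ // IsStandardPart n I ∧ Even I.card ∧
          Even (Finset.Icc 1 (2 * n) \ I).card} => pfPair n I.val) ∧
    Submodule.span ℝ
      {p | ∃ I : Finset ℕ, IsStandardPart n I ∧ Even I.card ∧
          Even (Finset.Icc 1 (2 * n) \ I).card ∧ p = pfPair n I} = Pn n := by
  have hN : Even (Finset.Icc 1 (2 * n)).card := by simp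
  constructor
  · rw [linearIndependent_iff']
    intro s g hg i hi
    have h0 : ∑ i ∈ s, (g i * (-1 : ℝ) ^ StdPf.inv i.1 (Finset.Icc 1 (2 * n) \ i.1)) •
        StdPf.G (Finset.Icc 1 (2 * n)) (Finset.Icc 1 (2 * n) \ i.1) = 0 := by
      rw [← hg]
      apply Finset.sum_congr rfl
      intro i _
      rw [StdPf.pfPair_eq i.2.1.1, smul_smul]
    have := StdPf.indep (Finset.Icc 1 (2 * n)) hN (fun i : {I : Finset ℕ // IsStandardPart n I ∧
      Even I.card ∧ Even (Finset.Icc 1 (2 * n) \ I).card} => Finset.Icc 1 (2 * n) \ i.1) ?_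
      (fun i => Finset.sdiff_subset) (fun i => i.2.2.2)
      (fun i => StdPf.lists_of_standard i.2.1) s _ h0 i hi
    · exact (mul_eq_zero.1 this).resolve_right (by simp)
    · intro i j hij
      apply Subtype.ext
      have h1 := Finset.inter_eq_right.2 i.2.1.1
      have h2 := Finset.inter_eq_right.2 j.2.1.1
      simp only at hij
      rw [← h1, ← h2, ← Finset.sdiff_sdiff_self_left, ← Finset.sdiff_sdiff_self_left, hij]
  · apply le_antisymm
    · apply Submodule.span_mono
      rintro p ⟨I, h1, h2, _, rfl⟩
      exact ⟨I, h1.1, h2, rfl⟩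
    · unfold Pn
      rw [Submodule.span_le]
      rintro p ⟨I, hI, hev, rfl⟩
      rw [StdPf.pfPair_eq hI, StdPf.G_compl]
      apply Submodule.smul_mem
      refine StdPf.span_main _ hN ?_ _ _ I hI hev rfl rfl
      intro B hB hBev hle hst
      have hs := StdPf.standard_of_counts hB hle hst
      have hBB : Finset.Icc 1 (2 * n) \ (Finset.Icc 1 (2 * n) \ B) = B := by
        rw [sdiff_sdiff_right_self]; exact Finset.inter_eq_right.2 hB
      have hp := StdPf.pfPair_eq hs.1
      rw [hBB] at hp
      have hG : StdPf.G (Finset.Icc 1 (2 * n)) B =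
          ((-1 : ℝ) ^ StdPf.inv (Finset.Icc 1 (2 * n) \ B) B) •
            pfPair n (Finset.Icc 1 (2 * n) \ B) := by
        rw [hp, smul_smul, ← mul_pow]
        simp
      rw [hG]
      apply Submodule.smul_mem
      apply Submodule.subset_span
      refine ⟨_, hs, ?_, ?_, rfl⟩
      · have := Finset.card_sdiff_add_card_eq_card hB
        rw [← this] at hN
        exact (Nat.even_add.1 hN).2 hBev
      · rw [hBB]; exact hBev
end
end

section
/- The dimension of P_n as an ℝ-vector space is C(2n−1, n), the binomial coefficient 2n−1 choose n. -/
open scoped Classical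
noncomputable section

def PMs (X : Finset ℕ) : Finset (Finset (ℕ × ℕ)) :=
  (X ×ˢ X).powerset.filter (fun π => IsPM X π)

lemma mem_PMs {X : Finset ℕ} {τ : Finset (ℕ × ℕ)} : τ ∈ PMs X ↔ IsPM X τ := by
  unfold PMs
  rw [Finset.mem_filter, Finset.mem_powerset]
  refine ⟨fun h => h.2, fun h => ⟨fun p hp => ?_, h⟩⟩
  have := h.1 p hp
  exact Finset.mem_product.2 ⟨this.1, this.2.1⟩

lemma IsPM.of_insert {X : Finset ℕ} {p : ℕ × ℕ} {τ : Finset (ℕ × ℕ)}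
    (h : IsPM X (insert p τ)) (hp : p ∉ τ) :
    ∃ X', X = insert p.1 (insert p.2 X') ∧ p.1 ∉ insert p.2 X' ∧ p.2 ∉ X' ∧ IsPM X' τ := by
  obtain ⟨h1, h2, h3⟩ := h
  have hpp := h1 p (Finset.mem_insert_self _ _)
  refine ⟨(X.erase p.1).erase p.2, ?_, ?_, ?_, ?_, ?_, ?_⟩
  · ext k
    simp only [Finset.mem_insert, Finset.mem_erase]
    grind
  · simp only [Finset.mem_insert, Finset.mem_erase]
    grind
  · simp
  · intro q hq
    have := h1 q (Finset.mem_insert_of_mem hq)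
    have h4 := h2 p (Finset.mem_insert_self _ _) q (Finset.mem_insert_of_mem hq)
      (by rintro rfl; exact hp hq)
    simp only [Finset.mem_erase]
    grind
  · intro q hq r hr
    exact h2 q (Finset.mem_insert_of_mem hq) r (Finset.mem_insert_of_mem hr)
  · intro k hk
    simp only [Finset.mem_erase] at hk
    obtain ⟨q, hq, hq'⟩ := h3 k hk.2.2
    rcases Finset.mem_insert.1 hq with rfl | hq
    · grind
    · exact ⟨q, hq, hq'⟩

lemma IsPM.insert' {X : Finset ℕ} {τ : Finset (ℕ × ℕ)} (h : IsPM X τ) {i j : ℕ}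
    (hij : i < j) (hi : i ∉ X) (hj : j ∉ X) : IsPM (insert i (insert j X)) (insert (i, j) τ) := by
  obtain ⟨h1, h2, h3⟩ := h
  refine ⟨?_, ?_, ?_⟩
  · intro p hp
    rcases Finset.mem_insert.1 hp with rfl | hp
    · simp [hij]
    · have := h1 p hp
      simp [this]
  · intro p hp q hq hpq
    rcases Finset.mem_insert.1 hp with rfl | hp <;> rcases Finset.mem_insert.1 hq with rfl | hq
    · exact absurd rfl hpq
    · have := h1 q hq
      grind
    · have := h1 p hp
      grind
    · exact h2 p hp q hq hpq
  · intro k hk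
    rcases Finset.mem_insert.1 hk with rfl | hk
    · exact ⟨(k, j), by simp, by simp⟩
    rcases Finset.mem_insert.1 hk with rfl | hk
    · exact ⟨(i, k), by simp, by simp⟩
    obtain ⟨p, hp, hp'⟩ := h3 k hk
    exact ⟨p, Finset.mem_insert_of_mem hp, hp'⟩

lemma IsPM.eq_empty {X : Finset ℕ} (h : IsPM X ∅) : X = ∅ := by
  apply Finset.eq_empty_of_forall_notMem
  intro k hk
  obtain ⟨p, hp, _⟩ := h.2.2 k hk
  simp at hp

lemma prod_PM {M : Type*} [CommMonoid M] (f : ℕ → M) (τ : Finset (ℕ × ℕ)) :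
    ∀ X, IsPM X τ → ∏ k ∈ X, f k = ∏ p ∈ τ, (f p.1 * f p.2) := by
  induction τ using Finset.induction_on with
  | empty => intro X h; simp [h.eq_empty]
  | insert p τ hp ih =>
    intro X h
    obtain ⟨X', rfl, h1, h2, h3⟩ := h.of_insert hp
    rw [Finset.prod_insert h1, Finset.prod_insert h2, Finset.prod_insert hp, ih X' h3, mul_assoc]

lemma sum_PM' {M : Type*} [AddCommMonoid M] (f : ℕ → M) (τ : Finset (ℕ × ℕ)) (X : Finset ℕ)
    (h : IsPM X τ) : ∑ k ∈ X, f k = ∑ p ∈ τ, (f p.1 + f p.2) :=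
  prod_PM (M := Multiplicative M) f τ X h

lemma sum_PM (F : ℕ × ℕ → Bool → Bool → ℝ) (τ : Finset (ℕ × ℕ)) :
    ∀ X, IsPM X τ → ∑ S ∈ X.powerset, ∏ p ∈ τ, F p (decide (p.1 ∈ S)) (decide (p.2 ∈ S))
      = ∏ p ∈ τ, (F p false false + F p false true + F p true false + F p true true) := by
  induction τ using Finset.induction_on with
  | empty => intro X h; simp [h.eq_empty]
  | insert p τ hp ih =>
    intro X h
    obtain ⟨X', rfl, h1, h2, h3⟩ := h.of_insert hp
    rw [Finset.sum_powerset_insert h1, Finset.sum_powerset_insert h2,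
      Finset.sum_powerset_insert h2, Finset.prod_insert hp, ← ih X' h3, Finset.mul_sum]
    simp only [← Finset.sum_add_distrib]
    refine Finset.sum_congr rfl fun S hS => ?_
    rw [Finset.mem_powerset] at hS
    simp only [Finset.prod_insert hp]
    have hne : ∀ q ∈ τ, q.1 ≠ p.1 ∧ q.1 ≠ p.2 ∧ q.2 ≠ p.1 ∧ q.2 ≠ p.2 := by
      intro q hq
      have := h3.1 q hq
      simp only [Finset.mem_insert] at h1
      grind
    have hp1 : p.1 ∉ S := fun h => h1 (Finset.mem_insert_of_mem (hS h))
    have hp2 : p.2 ∉ S := fun h => h2 (hS h)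
    have hp12 : p.1 ≠ p.2 := by rintro h; apply h1; simp [h]
    have e : ∀ T : Finset ℕ, (∀ k, k ≠ p.1 → k ≠ p.2 → (k ∈ T ↔ k ∈ S)) →
        ∏ q ∈ τ, F q (decide (q.1 ∈ T)) (decide (q.2 ∈ T)) =
        ∏ q ∈ τ, F q (decide (q.1 ∈ S)) (decide (q.2 ∈ S)) := by
      intro T hT
      refine Finset.prod_congr rfl fun q hq => ?_
      have := hne q hq
      rw [decide_eq_decide.2 (hT q.1 this.1 this.2.1), decide_eq_decide.2 (hT q.2 this.2.2.1 this.2.2.2)]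
    rw [e (insert p.2 S) (by intro k; simp; tauto), e (insert p.1 S) (by intro k; simp; tauto),
      e (insert p.1 (insert p.2 S)) (by intro k; simp; tauto)]
    simp [hp1, hp2, hp12, hp12.symm]
    ring

/-- indicator: `I` is a union of blocks of `τ` -/
def compF (I : Finset ℕ) (τ : Finset (ℕ × ℕ)) : ℝ :=
  ∏ p ∈ τ, if (decide (p.1 ∈ I) = decide (p.2 ∈ I)) then 1 else 0

/-- indicator: every block of `τ` is split by `S` -/
def splF (S : Finset ℕ) (τ : Finset (ℕ × ℕ)) : ℝ :=
  ∏ p ∈ τ, if (decide (p.1 ∈ S) = decide (p.2 ∈ S)) then 0 else 1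

lemma compF_eq (I : Finset ℕ) (τ : Finset (ℕ × ℕ)) :
    compF I τ = if ∀ p ∈ τ, (p.1 ∈ I ↔ p.2 ∈ I) then 1 else 0 := by
  unfold compF
  split_ifs with h
  · exact Finset.prod_eq_one fun p hp => by simp [h p hp]
  · push Not at h
    obtain ⟨p, hp, h⟩ := h
    refine Finset.prod_eq_zero hp ?_
    simp only [decide_eq_decide]; rw [if_neg]; tauto

lemma splF_eq (S : Finset ℕ) (τ : Finset (ℕ × ℕ)) :
    splF S τ = if ∀ p ∈ τ, ¬ (p.1 ∈ S ↔ p.2 ∈ S) then 1 else 0 := by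
  unfold splF
  split_ifs with h
  · exact Finset.prod_eq_one fun p hp => by simp [h p hp]
  · push Not at h
    obtain ⟨p, hp, h⟩ := h
    refine Finset.prod_eq_zero hp ?_
    simp only [decide_eq_decide]; rw [if_pos]; tauto

lemma IsPM.card {X : Finset ℕ} {τ : Finset (ℕ × ℕ)} (h : IsPM X τ) : X.card = 2 * τ.card := by
  rw [Finset.card_eq_sum_ones, sum_PM' _ τ X h]
  simp [mul_comm]

lemma IsPM.card_sub {X S : Finset ℕ} {τ : Finset (ℕ × ℕ)} (h : IsPM X τ) (hS : S ⊆ X) :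
    S.card = ∑ p ∈ τ, ((if p.1 ∈ S then 1 else 0) + (if p.2 ∈ S then 1 else 0)) := by
  rw [← sum_PM' (fun k => if k ∈ S then 1 else 0) τ X h, Finset.sum_ite_mem,
    Finset.inter_eq_right.2 hS, Finset.card_eq_sum_ones]

lemma card_of_spl {X S : Finset ℕ} {τ : Finset (ℕ × ℕ)} (h : IsPM X τ) (hS : S ⊆ X)
    (hs : splF S τ ≠ 0) : S.card = τ.card := by
  rw [splF_eq] at hs
  simp only [ne_eq, ite_eq_right_iff, one_ne_zero, imp_false, not_not] at hs
  rw [h.card_sub hS, Finset.card_eq_sum_ones]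
  refine Finset.sum_congr rfl fun p hp => ?_
  have := hs p hp
  split_ifs <;> tauto

lemma card_of_comp {X I : Finset ℕ} {τ : Finset (ℕ × ℕ)} (h : IsPM X τ) (hI : I ⊆ X)
    (hs : compF I τ ≠ 0) : I.card = 2 * ∑ p ∈ τ, (if p.1 ∈ I then 1 else 0) := by
  rw [compF_eq] at hs
  simp only [ne_eq, ite_eq_right_iff, one_ne_zero, imp_false, not_not] at hs
  rw [h.card_sub hI, Finset.mul_sum]
  refine Finset.sum_congr rfl fun p hp => ?_
  have := hs p hp
  split_ifs <;> tauto

lemma even_of_comp {X I : Finset ℕ} {τ : Finset (ℕ × ℕ)} (h : IsPM X τ) (hI : I ⊆ X)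
    (hs : compF I τ ≠ 0) : Even I.card := by
  rw [card_of_comp h hI hs]; simp

lemma half_sign {X I : Finset ℕ} {τ : Finset (ℕ × ℕ)} (h : IsPM X τ) (hI : I ⊆ X) :
    (-1 : ℝ) ^ (I.card / 2) * compF I τ = ∏ p ∈ τ,
      ((if decide (p.1 ∈ I) then -1 else 1) * if (decide (p.1 ∈ I) = decide (p.2 ∈ I)) then 1 else 0) := by
  rw [Finset.prod_mul_distrib]
  change _ = _ * compF I τ
  by_cases hs : compF I τ = 0
  · simp [hs]
  congr 1
  rw [card_of_comp h hI hs, Nat.mul_div_cancel_left _ two_pos, ← Finset.prod_pow_eq_pow_sum]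
  refine Finset.prod_congr rfl fun p hp => ?_
  by_cases hh : p.1 ∈ I <;> simp [hh]

lemma inter_sign {X S I : Finset ℕ} {τ : Finset (ℕ × ℕ)} (h : IsPM X τ) (hI : I ⊆ X) :
    (-1 : ℝ) ^ ((I ∩ S).card) = ∏ p ∈ τ,
      ((if decide (p.1 ∈ I) ∧ decide (p.1 ∈ S) then -1 else 1) *
        (if decide (p.2 ∈ I) ∧ decide (p.2 ∈ S) then -1 else 1)) := by
  rw [← prod_PM (fun k => if decide (k ∈ I) ∧ decide (k ∈ S) then (-1 : ℝ) else 1) τ X h,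
    Finset.prod_ite]
  simp only [Finset.prod_const, one_pow, mul_one]
  congr 2
  ext k
  simp
  intro h _
  exact hI h

lemma fourier_a {X I : Finset ℕ} {τ : Finset (ℕ × ℕ)} (h : IsPM X τ) (hI : I ⊆ X) :
    ∑ S ∈ X.powerset, (-1 : ℝ) ^ ((I ∩ S).card) * splF S τ =
      2 ^ τ.card * ((-1 : ℝ) ^ (I.card / 2) * compF I τ) := by
  rw [half_sign h hI, ← Finset.prod_const, ← Finset.prod_mul_distrib]
  simp only [inter_sign h hI, splF, ← Finset.prod_mul_distrib]
  rw [sum_PM (fun p a b => ((if decide (p.1 ∈ I) ∧ a then -1 else 1) *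
        (if decide (p.2 ∈ I) ∧ b then -1 else 1)) * if a = b then 0 else 1) τ X h]
  refine Finset.prod_congr rfl fun p hp => ?_
  by_cases h1 : p.1 ∈ I <;> by_cases h2 : p.2 ∈ I <;> simp [h1, h2] <;> norm_num

lemma fourier_b {X S : Finset ℕ} {τ : Finset (ℕ × ℕ)} (h : IsPM X τ) :
    ∑ I ∈ X.powerset, (-1 : ℝ) ^ ((I ∩ S).card) * ((-1 : ℝ) ^ (I.card / 2) * compF I τ) =
      2 ^ τ.card * splF S τ := by
  rw [splF, ← Finset.prod_const, ← Finset.prod_mul_distrib]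
  have : ∀ I ∈ X.powerset, (-1 : ℝ) ^ ((I ∩ S).card) * ((-1 : ℝ) ^ (I.card / 2) * compF I τ) =
     ∏ p ∈ τ,
      (((if decide (p.1 ∈ I) ∧ decide (p.1 ∈ S) then -1 else 1) *
        (if decide (p.2 ∈ I) ∧ decide (p.2 ∈ S) then -1 else 1)) *
      ((if decide (p.1 ∈ I) then -1 else 1) * if (decide (p.1 ∈ I) = decide (p.2 ∈ I)) then 1 else 0)) := by
    intro I hI
    rw [Finset.mem_powerset] at hI
    rw [half_sign h hI, inter_sign h hI, ← Finset.prod_mul_distrib]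
  rw [Finset.sum_congr rfl this]
  rw [sum_PM (fun p a b => (((if a ∧ decide (p.1 ∈ S) then -1 else 1) *
        (if b ∧ decide (p.2 ∈ S) then -1 else 1)) *
      ((if a then -1 else 1) * if (a = b) then 1 else 0))) τ X h]
  refine Finset.prod_congr rfl fun p hp => ?_
  by_cases h1 : p.1 ∈ S <;> by_cases h2 : p.2 ∈ S <;> simp [h1, h2] <;> norm_num

lemma splF_congr {S T : Finset ℕ} {τ : Finset (ℕ × ℕ)} {X : Finset ℕ} (h : IsPM X τ)
    (hST : ∀ k ∈ X, (k ∈ S ↔ k ∈ T)) : splF S τ = splF T τ := by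
  refine Finset.prod_congr rfl fun p hp => ?_
  have := h.1 p hp
  rw [decide_eq_decide.2 (hST _ this.1), decide_eq_decide.2 (hST _ this.2.1)]

lemma splF_compl {S : Finset ℕ} {τ : Finset (ℕ × ℕ)} {X : Finset ℕ} (h : IsPM X τ) :
    splF (X \ S) τ = splF S τ := by
  refine Finset.prod_congr rfl fun p hp => ?_
  have := h.1 p hp
  by_cases h1 : p.1 ∈ S <;> by_cases h2 : p.2 ∈ S <;> simp [h1, h2, this]

lemma splF_insert {S : Finset ℕ} {τ : Finset (ℕ × ℕ)} {p : ℕ × ℕ} (h : p ∉ τ) :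
    splF S (insert p τ) = (if (decide (p.1 ∈ S) = decide (p.2 ∈ S)) then 0 else 1) * splF S τ := by
  unfold splF
  rw [Finset.prod_insert h]

lemma indep (m : ℕ) : ∀ (X : Finset ℕ) (c : Finset ℕ → ℝ), X.card = 2 * m →
    (∀ S ⊆ X, c (X \ S) = c S) →
    (∀ τ, IsPM X τ → ∑ S ∈ X.powerset, splF S τ * c S = 0) →
    ∀ S ⊆ X, S.card = m → c S = 0 := by
  induction m with
  | zero =>
    intro X c hX _ h S hS hc
    have hX : X = ∅ := by simpa using hX
    subst hX
    have := h ∅ (by simp [IsPM])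
    simp [splF] at this
    rw [Finset.card_eq_zero.1 hc]; exact this
  | succ m ih =>
    intro X c hX hsym h
    have key0 : ∀ i j, i ∈ X → j ∈ X → i < j → ∀ R ⊆ (X.erase i).erase j, R.card = m →
        c (insert i R) + c (insert j R) = 0 := by
      intro i j hi hj hij
      set X' := (X.erase i).erase j with hX'
      have hiX : i ∉ insert j X' := by simp [hX']; omega
      have hjX : j ∉ X' := by simp [hX']
      have hiX' : i ∉ X' := by simp [hX']
      have hXX : X = insert i (insert j X') := by
        ext k; simp [hX']; grind
      apply ih X' (fun R => c (insert i R) + c (insert j R))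
      · rw [hXX, Finset.card_insert_of_notMem hiX, Finset.card_insert_of_notMem hjX] at hX
        omega
      · intro R hR
        have e1 : insert i (X' \ R) = X \ insert j R := by
          ext k; have := @hR k; simp [hXX]; grind
        have e2 : insert j (X' \ R) = X \ insert i R := by
          ext k; have := @hR k; simp [hXX]; grind
        have s1 : insert j R ⊆ X := by
          rw [hXX]; intro k; have := @hR k; simp; grind
        have s2 : insert i R ⊆ X := by
          rw [hXX]; intro k; have := @hR k; simp; grind
        simp only [e1, e2]
        rw [hsym _ s1, hsym _ s2, add_comm]
      · intro τ hτ
        have hn : (i, j) ∉ τ := fun hh => hiX' (hτ.1 _ hh).1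
        have h' := h (insert (i, j) τ) (by rw [hXX]; exact hτ.insert' hij hiX' hjX)
        rw [hXX, Finset.sum_powerset_insert hiX, Finset.sum_powerset_insert hjX,
          Finset.sum_powerset_insert hjX] at h'
        simp only [← Finset.sum_add_distrib] at h'
        rw [← h']
        refine Finset.sum_congr rfl fun S hS => ?_
        rw [Finset.mem_powerset] at hS
        have hiS : i ∉ S := fun h => hiX' (hS h)
        have hjS : j ∉ S := fun h => hjX (hS h)
        have c1 : splF (insert i S) τ = splF S τ := splF_congr hτ (by
          intro k hk; simp; rintro rfl; exact absurd hk hiX')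
        have c2 : splF (insert j S) τ = splF S τ := splF_congr hτ (by
          intro k hk; simp; rintro rfl; exact absurd hk hjX)
        simp only [splF_insert hn]
        simp [hiS, hjS, hij.ne, hij.ne', c1, c2]
        ring
    have key : ∀ i j, i ∈ X → j ∈ X → i ≠ j → ∀ R ⊆ X, i ∉ R → j ∉ R → R.card = m →
        c (insert i R) + c (insert j R) = 0 := by
      intro i j hi hj hij R hR hiR hjR hc
      have hsub : R ⊆ (X.erase i).erase j := by
        intro k hk
        simp only [Finset.mem_erase]
        exact ⟨by rintro rfl; exact hjR hk, by rintro rfl; exact hiR hk, hR hk⟩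
      rcases lt_or_gt_of_ne hij with h | h
      · exact key0 i j hi hj h R hsub hc
      · rw [add_comm]
        rw [Finset.erase_right_comm] at hsub
        exact key0 j i hj hi h R hsub hc
    intro S hS hc
    obtain ⟨a, ha⟩ : S.Nonempty := by rw [← Finset.card_pos]; omega
    have hR : (S.erase a).card = m := by rw [Finset.card_erase_of_mem ha]; omega
    have hSa : insert a (S.erase a) = S := Finset.insert_erase ha
    have hcd : (X \ S).card = m + 1 := by rw [Finset.card_sdiff_of_subset hS]; omega
    have hRX : S.erase a ⊆ X := (Finset.erase_subset _ _).trans hS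
    obtain ⟨b, hb⟩ : (X \ S).Nonempty := by rw [← Finset.card_pos]; omega
    rw [Finset.mem_sdiff] at hb
    have hab : a ≠ b := by rintro rfl; exact hb.2 ha
    have k1 := key a b (hS ha) hb.1 hab _ hRX (by simp) (by simp [hb.2]) hR
    rw [hSa] at k1
    rcases Nat.eq_zero_or_pos m with rfl | hm
    · have hS1 : S.erase a = ∅ := by simpa using hR
      have : X \ S = insert b (S.erase a) := by
        rw [hS1]
        obtain ⟨d, hd⟩ := Finset.card_eq_one.1 hcd
        have : b ∈ X \ S := Finset.mem_sdiff.2 hb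
        rw [hd] at this ⊢
        simp at this ⊢; exact this.symm
      rw [← this, hsym S hS] at k1
      linarith
    · obtain ⟨d, hd⟩ : ((X \ S).erase b).Nonempty := by
        rw [← Finset.card_pos, Finset.card_erase_of_mem (Finset.mem_sdiff.2 hb)]; omega
      simp only [Finset.mem_erase, Finset.mem_sdiff] at hd
      have had : a ≠ d := by rintro rfl; exact hd.2.2 ha
      have k2 := key a d (hS ha) hd.2.1 had _ hRX (by simp) (by simp [hd.2.2]) hR
      have k3 := key b d hb.1 hd.2.1 hd.1.symm _ hRX (by simp [hb.2]) (by simp [hd.2.2]) hR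
      rw [hSa] at k2
      linarith

def chi (p q : ℕ × ℕ) : ℝ := if p.1 < q.1 ∧ q.1 < p.2 ∧ p.2 < q.2 then -1 else 1

def tt (k j : ℕ) : ℝ := if j < k then -1 else 1

def sgnI (I J : Finset ℕ) : ℝ := ∏ k ∈ I, ∏ j ∈ J, tt k j

lemma sign_cross (π : Finset (ℕ × ℕ)) : (-1 : ℝ) ^ crossNum π = ∏ p ∈ π, ∏ q ∈ π, chi p q := by
  unfold crossNum chi
  rw [← Finset.prod_product', Finset.prod_ite]
  simp

lemma sgnI_ne (I J : Finset ℕ) : sgnI I J ≠ 0 := by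
  unfold sgnI tt
  refine Finset.prod_ne_zero_iff.2 fun k _ => Finset.prod_ne_zero_iff.2 fun j _ => ?_
  split_ifs <;> norm_num

lemma chi_mix {p q : ℕ × ℕ} (hp : p.1 < p.2) (hq : q.1 < q.2) (h1 : p.1 ≠ q.1) (h2 : p.1 ≠ q.2)
    (h3 : p.2 ≠ q.1) (h4 : p.2 ≠ q.2) :
    chi p q * chi q p = (tt p.1 q.1 * tt p.1 q.2) * (tt p.2 q.1 * tt p.2 q.2) := by
  unfold chi tt
  split_ifs <;> first | omega | norm_num

lemma PM_disj {I J : Finset ℕ} (hIJ : Disjoint I J) {π σ : Finset (ℕ × ℕ)} (hπ : IsPM I π)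
    (hσ : IsPM J σ) : Disjoint π σ := by
  rw [Finset.disjoint_left] at hIJ ⊢
  exact fun p hp hq => hIJ (hπ.1 p hp).1 (hσ.1 p hq).1

lemma sign_union {I J : Finset ℕ} (hIJ : Disjoint I J) {π σ : Finset (ℕ × ℕ)} (hπ : IsPM I π)
    (hσ : IsPM J σ) :
    (-1 : ℝ) ^ crossNum (π ∪ σ) = sgnI I J * ((-1) ^ crossNum π * (-1) ^ crossNum σ) := by
  have hd := PM_disj hIJ hπ hσ
  rw [Finset.disjoint_left] at hIJ
  have e : sgnI I J = ∏ p ∈ π, ∏ q ∈ σ, (chi p q * chi q p) := by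
    unfold sgnI
    rw [prod_PM _ π I hπ]
    refine Finset.prod_congr rfl fun p hp => ?_
    rw [prod_PM _ σ J hσ, prod_PM _ σ J hσ, ← Finset.prod_mul_distrib]
    refine Finset.prod_congr rfl fun q hq => ?_
    have a := hπ.1 p hp
    have b := hσ.1 q hq
    rw [chi_mix a.2.2 b.2.2]
    · intro h; exact hIJ a.1 (h ▸ b.1)
    · intro h; exact hIJ a.1 (h ▸ b.2.1)
    · intro h; exact hIJ a.2.1 (h ▸ b.1)
    · intro h; exact hIJ a.2.1 (h ▸ b.2.1)
  simp only [sign_cross, Finset.prod_union hd, Finset.prod_mul_distrib, e]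
  rw [Finset.prod_comm (s := σ) (t := π)]
  ring

lemma IsPM.union {I J : Finset ℕ} (hIJ : Disjoint I J) {π σ : Finset (ℕ × ℕ)} (hπ : IsPM I π)
    (hσ : IsPM J σ) : IsPM (I ∪ J) (π ∪ σ) := by
  rw [Finset.disjoint_left] at hIJ
  refine ⟨?_, ?_, ?_⟩
  · intro p hp
    rcases Finset.mem_union.1 hp with hp | hp
    · have := hπ.1 p hp; simp [this]
    · have := hσ.1 p hp; simp [this]
  · intro p hp q hq hpq
    rcases Finset.mem_union.1 hp with hp | hp <;> rcases Finset.mem_union.1 hq with hq | hq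
    · exact hπ.2.1 p hp q hq hpq
    · have := hπ.1 p hp; have := hσ.1 q hq; grind
    · have := hσ.1 p hp; have := hπ.1 q hq; grind
    · exact hσ.2.1 p hp q hq hpq
  · intro k hk
    rcases Finset.mem_union.1 hk with hk | hk
    · obtain ⟨p, hp, h⟩ := hπ.2.2 k hk
      exact ⟨p, Finset.mem_union_left _ hp, h⟩
    · obtain ⟨p, hp, h⟩ := hσ.2.2 k hk
      exact ⟨p, Finset.mem_union_right _ hp, h⟩

lemma IsPM.filter {X I : Finset ℕ} (hI : I ⊆ X) {τ : Finset (ℕ × ℕ)} (h : IsPM X τ)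
    (hc : ∀ p ∈ τ, (p.1 ∈ I ↔ p.2 ∈ I)) : IsPM I (τ.filter fun p => p.1 ∈ I) := by
  refine ⟨?_, ?_, ?_⟩
  · intro p hp
    rw [Finset.mem_filter] at hp
    exact ⟨hp.2, (hc p hp.1).1 hp.2, (h.1 p hp.1).2.2⟩
  · intro p hp q hq
    exact h.2.1 p (Finset.mem_filter.1 hp).1 q (Finset.mem_filter.1 hq).1
  · intro k hk
    obtain ⟨p, hp, h'⟩ := h.2.2 k (hI hk)
    refine ⟨p, Finset.mem_filter.2 ⟨hp, ?_⟩, h'⟩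
    rcases h' with rfl | rfl
    · exact hk
    · exact (hc p hp).2 hk

def mono (τ : Finset (ℕ × ℕ)) : MvPolynomial (ℕ × ℕ) ℝ := ∏ p ∈ τ, MvPolynomial.X p

def Phi (X : Finset ℕ) : (Finset (ℕ × ℕ) → ℝ) →ₗ[ℝ] MvPolynomial (ℕ × ℕ) ℝ where
  toFun f := ∑ τ ∈ PMs X, (f τ * (-1) ^ crossNum τ) • mono τ
  map_add' f g := by simp [add_mul, add_smul, Finset.sum_add_distrib]
  map_smul' r f := by simp [mul_assoc, mul_smul, Finset.smul_sum]

lemma Phi_congr {X : Finset ℕ} {f g : Finset (ℕ × ℕ) → ℝ} (h : ∀ τ, IsPM X τ → f τ = g τ) :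
    Phi X f = Phi X g :=
  Finset.sum_congr rfl fun τ hτ => by rw [h τ (mem_PMs.1 hτ)]

lemma mono_eq (τ : Finset (ℕ × ℕ)) :
    mono τ = MvPolynomial.monomial (∑ p ∈ τ, Finsupp.single p 1) 1 := by
  rw [MvPolynomial.monomial_sum_one]; rfl

lemma expo_inj {τ τ' : Finset (ℕ × ℕ)}
    (h : (∑ p ∈ τ, Finsupp.single p 1 : (ℕ × ℕ) →₀ ℕ) = ∑ p ∈ τ', Finsupp.single p 1) : τ = τ' := by
  ext q
  have := DFunLike.congr_fun h q
  simp only [Finsupp.finsetSum_apply, Finsupp.single_apply, Finset.sum_ite_eq'] at this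
  by_cases h1 : q ∈ τ <;> by_cases h2 : q ∈ τ' <;> simp_all

lemma Phi_inj {X : Finset ℕ} {f : Finset (ℕ × ℕ) → ℝ} (h : Phi X f = 0) {τ : Finset (ℕ × ℕ)}
    (hτ : IsPM X τ) : f τ = 0 := by
  have h' := congrArg (MvPolynomial.coeff (∑ p ∈ τ, Finsupp.single p 1)) h
  change MvPolynomial.coeff _ (∑ τ ∈ PMs X, (f τ * (-1) ^ crossNum τ) • mono τ) = _ at h'
  rw [MvPolynomial.coeff_sum, Finset.sum_eq_single τ] at h'
  · simpa [mono_eq] using h'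
  · intro σ _ hne
    rw [mono_eq, MvPolynomial.coeff_smul, MvPolynomial.coeff_monomial, if_neg]
    · simp
    · exact fun h => hne (expo_inj h)
  · intro h; exact absurd (mem_PMs.2 hτ) h

lemma pfSub_eq (I : Finset ℕ) :
    pfSub genA I = ∑ π ∈ PMs I, ((-1 : ℝ) ^ crossNum π) • mono π := by
  unfold pfSub
  refine Finset.sum_congr rfl fun π hπ => ?_
  have hπ := (Finset.mem_filter.1 hπ).2
  rw [MvPolynomial.smul_eq_C_mul]
  congr 1
  · simp
  · refine Finset.prod_congr rfl fun p hp => ?_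
    simp [genA, (hπ.1 p hp).2.2]

lemma pair_eq {X I : Finset ℕ} (hI : I ⊆ X) :
    pfSub genA I * pfSub genA (X \ I) = sgnI I (X \ I) • Phi X (compF I) := by
  have hdis : Disjoint I (X \ I) := Finset.disjoint_sdiff
  have hun : I ∪ X \ I = X := Finset.union_sdiff_of_subset hI
  change _ = _ • ∑ τ ∈ PMs X, (compF I τ * (-1) ^ crossNum τ) • mono τ
  have e1 : ∑ τ ∈ PMs X, (compF I τ * (-1) ^ crossNum τ) • mono τ =
      ∑ τ ∈ (PMs X).filter (fun τ => ∀ p ∈ τ, (p.1 ∈ I ↔ p.2 ∈ I)),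
        ((-1 : ℝ) ^ crossNum τ) • mono τ := by
    rw [Finset.sum_filter]
    refine Finset.sum_congr rfl fun τ _ => ?_
    rw [compF_eq]
    split_ifs <;> simp
  rw [e1, pfSub_eq, pfSub_eq, Finset.sum_mul_sum, ← Finset.sum_product', Finset.smul_sum]
  refine Finset.sum_bij' (fun a _ => a.1 ∪ a.2)
    (fun τ _ => (τ.filter fun p => p.1 ∈ I, τ.filter fun p => p.1 ∈ X \ I)) ?_ ?_ ?_ ?_ ?_
  · rintro ⟨π, σ⟩ h
    rw [Finset.mem_product, mem_PMs, mem_PMs] at h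
    rw [Finset.mem_filter, mem_PMs]
    refine ⟨by have := h.1.union hdis h.2; rwa [hun] at this, ?_⟩
    intro p hp
    rcases Finset.mem_union.1 hp with hp | hp
    · have := h.1.1 p hp; tauto
    · have := h.2.1 p hp; simp only [Finset.mem_sdiff] at this; tauto
  · intro τ h
    rw [Finset.mem_filter, mem_PMs] at h
    rw [Finset.mem_product, mem_PMs, mem_PMs]
    refine ⟨h.1.filter hI h.2, h.1.filter Finset.sdiff_subset ?_⟩
    intro p hp
    have := h.1.1 p hp
    have := h.2 p hp
    simp only [Finset.mem_sdiff]; tauto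
  · rintro ⟨π, σ⟩ h
    rw [Finset.mem_product, mem_PMs, mem_PMs] at h
    ext p
    · have a := h.1.1 p
      have b := h.2.1 p
      simp only [Finset.mem_sdiff, Finset.mem_filter, Finset.mem_union] at *
      tauto
    · have a := h.1.1 p
      have b := h.2.1 p
      simp only [Finset.mem_sdiff, Finset.mem_filter, Finset.mem_union] at *
      tauto
  · intro τ h
    rw [Finset.mem_filter, mem_PMs] at h
    ext p
    have := h.1.1 p
    simp only [Finset.mem_sdiff, Finset.mem_filter, Finset.mem_union]
    tauto
  · rintro ⟨π, σ⟩ h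
    rw [Finset.mem_product, mem_PMs, mem_PMs] at h
    simp only
    have hm : mono (π ∪ σ) = mono π * mono σ := Finset.prod_union (PM_disj hdis h.1 h.2)
    have hs : sgnI I (X \ I) * sgnI I (X \ I) = 1 := by
      unfold sgnI tt
      simp only [← Finset.prod_mul_distrib]
      refine Finset.prod_eq_one fun k _ => Finset.prod_eq_one fun j _ => ?_
      split_ifs <;> norm_num
    rw [sign_union hdis h.1 h.2, hm, smul_smul, ← mul_assoc, hs, one_mul, smul_mul_smul_comm]

lemma Phi_spl_mem {n : ℕ} (hn : 1 ≤ n) {S : Finset ℕ} (hS : S ⊆ Finset.Icc 1 (2 * n)) :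
    Phi (Finset.Icc 1 (2 * n)) (splF S) ∈ Submodule.span ℝ (Set.range
      fun T : Finset.powersetCard n (Finset.Icc 2 (2 * n)) => Phi (Finset.Icc 1 (2 * n)) (splF T)) := by
  have hX : (Finset.Icc 1 (2 * n)).card = 2 * n := by simp
  by_cases hc : S.card = n
  · by_cases h1 : 1 ∈ S
    · rw [← Phi_congr (f := splF (Finset.Icc 1 (2 * n) \ S)) (fun τ hτ => splF_compl hτ)]
      refine Submodule.subset_span ⟨⟨Finset.Icc 1 (2 * n) \ S, ?_⟩, rfl⟩
      rw [Finset.mem_powersetCard]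
      constructor
      · intro k hk
        simp only [Finset.mem_sdiff, Finset.mem_Icc] at hk ⊢
        have : k ≠ 1 := by rintro rfl; exact hk.2 h1
        omega
      · rw [Finset.card_sdiff_of_subset hS]; omega
    · refine Submodule.subset_span ⟨⟨S, ?_⟩, rfl⟩
      rw [Finset.mem_powersetCard]
      refine ⟨?_, hc⟩
      intro k hk
      have h2 := hS hk
      simp only [Finset.mem_Icc] at h2 ⊢
      have : k ≠ 1 := by rintro rfl; exact h1 hk
      omega
  · rw [Phi_congr (g := 0)]
    · simp
    · intro τ hτ
      by_contra h
      have := card_of_spl hτ hS h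
      have := hτ.card
      omega

lemma Pn_eq {n : ℕ} (hn : 1 ≤ n) : Pn n = Submodule.span ℝ (Set.range
      fun T : Finset.powersetCard n (Finset.Icc 2 (2 * n)) => Phi (Finset.Icc 1 (2 * n)) (splF T)) := by
  have hX : (Finset.Icc 1 (2 * n)).card = 2 * n := by simp
  have hcard : ∀ τ, IsPM (Finset.Icc 1 (2 * n)) τ → τ.card = n := by
    intro τ h; have := h.card; omega
  apply le_antisymm
  · unfold Pn
    rw [Submodule.span_le]
    rintro _ ⟨I, hI, _, rfl⟩
    rw [SetLike.mem_coe, pfPair, pair_eq hI]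
    apply Submodule.smul_mem
    have : Phi (Finset.Icc 1 (2 * n)) (compF I) = ((2 ^ n)⁻¹ * (-1 : ℝ) ^ (I.card / 2)) •
        ∑ S ∈ (Finset.Icc 1 (2 * n)).powerset,
          ((-1 : ℝ) ^ ((I ∩ S).card)) • Phi (Finset.Icc 1 (2 * n)) (splF S) := by
      simp only [← map_smul, ← map_sum]
      apply Phi_congr
      intro τ hτ
      have := fourier_a hτ hI
      rw [hcard τ hτ] at this
      simp only [Pi.smul_apply, Finset.sum_apply, smul_eq_mul]
      rw [this]
      have h2 : (-1 : ℝ) ^ (I.card / 2) * (-1 : ℝ) ^ (I.card / 2) = 1 := by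
        rw [← mul_pow]; simp
      have h3 : (2 ^ n : ℝ)⁻¹ * 2 ^ n = 1 := inv_mul_cancel₀ (by positivity)
      linear_combination (-(compF I τ) * ((2 ^ n : ℝ)⁻¹ * 2 ^ n)) * h2 - compF I τ * h3
    rw [this]
    apply Submodule.smul_mem
    refine Submodule.sum_mem _ fun S hS => Submodule.smul_mem _ _ ?_
    exact Phi_spl_mem hn (Finset.mem_powerset.1 hS)
  · rw [Submodule.span_le]
    rintro _ ⟨⟨S, hS⟩, rfl⟩
    simp only
    rw [SetLike.mem_coe]
    have : Phi (Finset.Icc 1 (2 * n)) (splF S) = ((2 ^ n : ℝ)⁻¹) •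
        ∑ I ∈ (Finset.Icc 1 (2 * n)).powerset,
          ((-1 : ℝ) ^ ((I ∩ S).card) * (-1 : ℝ) ^ (I.card / 2)) •
            Phi (Finset.Icc 1 (2 * n)) (compF I) := by
      simp only [← map_smul, ← map_sum]
      apply Phi_congr
      intro τ hτ
      have := fourier_b (S := S) hτ
      rw [hcard τ hτ] at this
      simp only [Pi.smul_apply, Finset.sum_apply, smul_eq_mul, mul_assoc]
      rw [this, inv_mul_cancel_left₀ (by positivity)]
    rw [this]
    apply Submodule.smul_mem
    refine Submodule.sum_mem _ fun I hI => Submodule.smul_mem _ _ ?_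
    rw [Finset.mem_powerset] at hI
    by_cases hev : Even I.card
    · have := pair_eq hI
      rw [← inv_smul_eq_iff₀ (sgnI_ne _ _)] at this
      rw [← this]
      exact Submodule.smul_mem _ _ (Submodule.subset_span ⟨I, hI, hev, rfl⟩)
    · rw [Phi_congr (g := 0)]
      · simp
      · intro τ hτ
        by_contra h
        exact hev (even_of_comp hτ hI h)

lemma spl_indep {n : ℕ} (hn : 1 ≤ n) : LinearIndependent ℝ
      (fun T : Finset.powersetCard n (Finset.Icc 2 (2 * n)) =>
        Phi (Finset.Icc 1 (2 * n)) (splF T)) := by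
  set X := Finset.Icc 1 (2 * n) with hXdef
  set Y := Finset.Icc 2 (2 * n) with hYdef
  have hX : X.card = 2 * n := by simp [hXdef]
  have h1Y : 1 ∉ Y := by simp [hYdef]
  have hXY : X = insert 1 Y := by
    ext k; simp [hXdef, hYdef]; omega
  have hYX : Y ⊆ X := by rw [hXY]; exact Finset.subset_insert _ _
  have h1X : 1 ∈ X := by rw [hXY]; simp
  rw [Fintype.linearIndependent_iff]
  intro g0 hg
  set g : Finset ℕ → ℝ := fun S => if h : S ∈ Finset.powersetCard n Y then g0 ⟨S, h⟩ else 0 with hgdef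
  have hg' : ∀ T, g0 T = g T := by
    rintro ⟨T, hT⟩; simp only [hgdef, dif_pos hT]
  simp only [hg', ← map_smul, ← map_sum] at hg
  have key : ∀ τ, IsPM X τ → ∑ S ∈ Y.powerset, splF S τ * g S = 0 := by
    intro τ hτ
    have := Phi_inj hg hτ
    simp only [Finset.sum_apply, Pi.smul_apply, smul_eq_mul] at this
    rw [Finset.sum_coe_sort (Finset.powersetCard n Y) (fun T => g T * splF T τ)] at this
    rw [← this]
    symm
    rw [Finset.sum_congr rfl (fun S _ => mul_comm _ _)]
    apply Finset.sum_subset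
    · intro S hS; exact Finset.mem_powerset.2 (Finset.mem_powersetCard.1 hS).1
    · intro S _ hS
      have : g S = 0 := dif_neg hS
      rw [this, mul_zero]
  have fin := indep n X (fun S => if 1 ∈ S then g (X \ S) else g S) hX ?_ ?_
  · rintro ⟨T, hT⟩
    rw [hg']
    have hT' := Finset.mem_powersetCard.1 hT
    have := fin T (hT'.1.trans hYX) hT'.2
    simpa [show 1 ∉ T from fun h => h1Y (hT'.1 h)] using this
  · intro S hS
    by_cases h1 : 1 ∈ S
    · simp [h1]
    · simp [h1, h1X, Finset.inter_eq_right.2 hS]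
  · intro τ hτ
    have hk := key τ hτ
    rw [hXY, Finset.sum_powerset_insert h1Y, ← hXY]
    have a : ∑ S ∈ Y.powerset, splF S τ * (if 1 ∈ S then g (X \ S) else g S) = 0 := by
      rw [← hk]
      refine Finset.sum_congr rfl fun S hS => ?_
      rw [if_neg fun h => h1Y (Finset.mem_powerset.1 hS h)]
    have b : ∑ S ∈ Y.powerset, splF (insert 1 S) τ *
        (if 1 ∈ insert 1 S then g (X \ insert 1 S) else g (insert 1 S)) = 0 := by
      rw [← hk]
      refine Finset.sum_bij' (fun S _ => Y \ S) (fun S _ => Y \ S) ?_ ?_ ?_ ?_ ?_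
      · intro S _; exact Finset.mem_powerset.2 Finset.sdiff_subset
      · intro S _; exact Finset.mem_powerset.2 Finset.sdiff_subset
      · intro S hS; exact Finset.sdiff_sdiff_eq_self (Finset.mem_powerset.1 hS)
      · intro S hS; exact Finset.sdiff_sdiff_eq_self (Finset.mem_powerset.1 hS)
      · intro S hS
        have e : X \ insert 1 S = Y \ S := by
          ext k; rw [hXY]; simp only [Finset.mem_sdiff, Finset.mem_insert]
          have : k = 1 → k ∉ Y := by rintro rfl; exact h1Y
          tauto
        rw [if_pos (Finset.mem_insert_self _ _), e, ← e, splF_compl hτ]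
    rw [a, b, add_zero]

/-- The dimension of `P_n` as an ℝ-vector space is `C(2n−1, n)`. -/
theorem Pn_finrank (n : ℕ) (hn : 1 ≤ n) :
    Module.finrank ℝ ↥(Pn n) = Nat.choose (2 * n - 1) n := by
  rw [Pn_eq hn, finrank_span_eq_card (spl_indep hn), Fintype.card_coe, Finset.card_powersetCard]
  congr 1
  simp
end
end
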